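/- There exists a constant C > 0 such that for every cube Q of side length 1, every f ∈ rbmo(μ) with ‖f‖_{rbmo(μ)} > 0, and every ψ ∈ L¹(μ), one has ‖fψ‖_{L^℘(Q,μ)} ≤ C ‖f‖_{rbmo(μ)} ∫_Q |ψ| dμ. -/

import Mathlib

open MeasureTheory Metric Set Filter
open scoped ENNReal NNReal BigOperators Topology

noncomputable section

/-- Euclidean space `ℝ^d`. -/
abbrev Euc (d : ℕ) := EuclideanSpace ℝ (Fin d)

/-- A (closed, axis-parallel) cube in `ℝ^d`, given by its center and side length. -/
structure Cube (d : ℕ) where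
  center : Euc d
  side : ℝ

namespace Cube

/-- The underlying set of a cube. -/
def set {d : ℕ} (Q : Cube d) : Set (Euc d) :=
  {y : Euc d | ∀ i, |y i - Q.center i| ≤ Q.side / 2}

/-- The concentric dilate `αQ` of a cube. -/
def dilate {d : ℕ} (Q : Cube d) (α : ℝ) : Cube d := ⟨Q.center, α * Q.side⟩

end Cube

/-- `Q` is a genuine cube for `μ`: positive side length, centered at a point of `supp μ`. -/
def IsCube {d : ℕ} (μ : Measure (Euc d)) (Q : Cube d) : Prop :=
  0 < Q.side ∧ ∀ r : ℝ, 0 < r → 0 < μ (Metric.ball Q.center r)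

/-- The mean value `f_Q = μ(Q)⁻¹ ∫_Q f dμ`. -/
def cubeAvg {d : ℕ} (μ : Measure (Euc d)) (Q : Cube d) (f : Euc d → ℝ) : ℝ :=
  (μ Q.set).toReal⁻¹ * ∫ x in Q.set, f x ∂μ

/-- `N_{Q,R}`: the smallest positive integer `k` with `2^k ℓ(Q) ≥ ℓ(R)`. -/
def NQR {d : ℕ} (Q R : Cube d) : ℕ :=
  sInf {k : ℕ | 0 < k ∧ R.side ≤ 2 ^ k * Q.side}

/-- The Tolsa coefficient `S_{Q,R} = 1 + ∑_{k=1}^{N_{Q,R}} μ(2^k Q)/ℓ(2^k Q)^n`. -/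
def SQR {d : ℕ} (μ : Measure (Euc d)) (n : ℕ) (Q R : Cube d) : ℝ :=
  1 + ∑ k ∈ Finset.Icc 1 (NQR Q R),
      (μ (Q.dilate (2 ^ k)).set).toReal / (2 ^ k * Q.side) ^ n

/-- `Q` is `(α,β)`-doubling: `μ(αQ) ≤ β μ(Q)`. -/
def IsDoubling {d : ℕ} (μ : Measure (Euc d)) (α β : ℝ) (Q : Cube d) : Prop :=
  μ (Q.dilate α).set ≤ ENNReal.ofReal β * μ Q.set

/-- `Q̃ = 2^N Q`, `N` the smallest non-negative integer making `2^N Q` `(ρ,β)`-doubling. -/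
def tilde {d : ℕ} (μ : Measure (Euc d)) (ρ β : ℝ) (Q : Cube d) : Cube d :=
  Q.dilate (2 ^ sInf {N : ℕ | IsDoubling μ ρ β (Q.dilate (2 ^ N))})

/-- `C` is an `RBMO(μ)` bound for `f` (with parameters `η, ρ, β`). -/
def RBMOBound {d : ℕ} (μ : Measure (Euc d)) (n : ℕ) (η ρ β : ℝ)
    (f : Euc d → ℝ) (C : ℝ) : Prop :=
  (∀ Q : Cube d, IsCube μ Q →
      ∫ x in Q.set, |f x - cubeAvg μ (tilde μ ρ β Q) f| ∂μ
        ≤ C * (μ (Q.dilate η).set).toReal) ∧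
  (∀ Q R : Cube d, IsCube μ Q → IsCube μ R → Q.set ⊆ R.set →
      IsDoubling μ ρ β Q → IsDoubling μ ρ β R →
      |cubeAvg μ Q f - cubeAvg μ R f| ≤ C * SQR μ n Q R)

/-- `f ∈ RBMO(μ)`. -/
def MemRBMO {d : ℕ} (μ : Measure (Euc d)) (n : ℕ) (η ρ β : ℝ) (f : Euc d → ℝ) : Prop :=
  LocallyIntegrable f μ ∧ ∃ C : ℝ, 0 ≤ C ∧ RBMOBound μ n η ρ β f C

/-- The `RBMO(μ)` norm of `f`. -/
def rbmoNorm {d : ℕ} (μ : Measure (Euc d)) (n : ℕ) (η ρ β : ℝ) (f : Euc d → ℝ) : ℝ :=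
  sInf {C : ℝ | 0 ≤ C ∧ RBMOBound μ n η ρ β f C}

/-- `C` is an `rbmo(μ)` (local `RBMO`) bound for `f`. -/
def RbmoLocBound {d : ℕ} (μ : Measure (Euc d)) (n : ℕ) (η ρ β : ℝ)
    (f : Euc d → ℝ) (C : ℝ) : Prop :=
  (∀ Q : Cube d, IsCube μ Q → Q.side ≤ 1 →
      ∫ x in Q.set, |f x - cubeAvg μ (tilde μ ρ β Q) f| ∂μ
        ≤ C * (μ (Q.dilate η).set).toReal) ∧
  (∀ Q R : Cube d, IsCube μ Q → IsCube μ R → Q.side ≤ 1 → Q.set ⊆ R.set →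
      IsDoubling μ ρ β Q → IsDoubling μ ρ β R →
      |cubeAvg μ Q f - cubeAvg μ R f| ≤ C * SQR μ n Q R) ∧
  (∀ Q : Cube d, IsCube μ Q → 1 < Q.side →
      ∫ x in Q.set, |f x| ∂μ ≤ C * (μ (Q.dilate η).set).toReal)

/-- `f ∈ rbmo(μ)`. -/
def MemRbmoLoc {d : ℕ} (μ : Measure (Euc d)) (n : ℕ) (η ρ β : ℝ) (f : Euc d → ℝ) : Prop :=
  LocallyIntegrable f μ ∧ ∃ C : ℝ, 0 ≤ C ∧ RbmoLocBound μ n η ρ β f C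

/-- The `rbmo(μ)` norm of `f`. -/
def rbmoLocNorm {d : ℕ} (μ : Measure (Euc d)) (n : ℕ) (η ρ β : ℝ) (f : Euc d → ℝ) : ℝ :=
  sInf {C : ℝ | 0 ≤ C ∧ RbmoLocBound μ n η ρ β f C}

/-- The data of an `∞`-block: `b = ∑ λ_j a_j`, supported in `R`, with `a_j` supported
in `Q_j ⊂ R` and `‖a_j‖_{L^∞(μ)} ≤ (μ(2Q_j) S_{Q_j,R})⁻¹`, `∑_j |λ_j| < ∞`. -/
structure PreBlock {d : ℕ} (μ : Measure (Euc d)) (n : ℕ) : Type where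
  R : Cube d
  Qs : ℕ → Cube d
  lam : ℕ → ℝ
  a : ℕ → Euc d → ℝ
  isCubeR : IsCube μ R
  isCubeQs : ∀ j, IsCube μ (Qs j)
  subsetQR : ∀ j, (Qs j).set ⊆ R.set
  measA : ∀ j, Measurable (a j)
  suppA : ∀ j, Function.support (a j) ⊆ (Qs j).set
  boundA : ∀ j x, |a j x| ≤ ((μ ((Qs j).dilate 2).set).toReal * SQR μ n (Qs j) R)⁻¹
  summable : Summable fun j => |lam j|

/-- The function determined by a block. -/
def PreBlock.fn {d : ℕ} {μ : Measure (Euc d)} {n : ℕ} (b : PreBlock μ n) : Euc d → ℝ :=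
  fun x => ∑' j, b.lam j * b.a j x

/-- `|b| = ∑_j |λ_j|`. -/
def PreBlock.size {d : ℕ} {μ : Measure (Euc d)} {n : ℕ} (b : PreBlock μ n) : ℝ :=
  ∑' j, |b.lam j|

/-- An `∞`-atomic block: an `∞`-block with vanishing integral. -/
structure AtomicBlock {d : ℕ} (μ : Measure (Euc d)) (n : ℕ) extends PreBlock μ n where
  cancel : ∫ x, (∑' j, lam j * a j x) ∂μ = 0

/-- The function determined by an atomic block. -/
def AtomicBlock.fn {d : ℕ} {μ : Measure (Euc d)} {n : ℕ} (b : AtomicBlock μ n) : Euc d → ℝ :=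
  b.toPreBlock.fn

/-- `|b|_{H¹} = ∑_j |λ_j|`. -/
def AtomicBlock.size {d : ℕ} {μ : Measure (Euc d)} {n : ℕ} (b : AtomicBlock μ n) : ℝ :=
  b.toPreBlock.size

/-- The class of test functions `F(x)` of Tolsa's grand maximal function. -/
def TestFun {d : ℕ} (μ : Measure (Euc d)) (n : ℕ) (x : Euc d) (φ : Euc d → ℝ) : Prop :=
  Integrable φ μ ∧ ContDiff ℝ 1 φ ∧ (∫ y, |φ y| ∂μ) ≤ 1 ∧
  (∀ y, 0 ≤ φ y) ∧ (∀ y, y ≠ x → φ y ≤ (‖y - x‖ ^ n)⁻¹) ∧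
  (∀ y, y ≠ x → ‖fderiv ℝ φ y‖ ≤ (‖y - x‖ ^ (n + 1))⁻¹)

/-- The grand maximal function `M f(x) = sup_{φ ∈ F(x)} |∫ f φ dμ|`. -/
def grandM {d : ℕ} (μ : Measure (Euc d)) (n : ℕ) (f : Euc d → ℝ) (x : Euc d) : ℝ :=
  sSup {r : ℝ | ∃ φ : Euc d → ℝ, TestFun μ n x φ ∧ r = |∫ y, f y * φ y ∂μ|}

/-- The local class `F_loc(x)`: test functions supported in the cube `Q(x,1)`. -/
def TestFunLoc {d : ℕ} (μ : Measure (Euc d)) (n : ℕ) (x : Euc d) (φ : Euc d → ℝ) : Prop :=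
  TestFun μ n x φ ∧ Function.support φ ⊆ (Cube.mk x 1).set

/-- The local grand maximal function `M^{(1)} f(x) = sup_{φ ∈ F_loc(x)} |∫ f φ dμ|`. -/
def grandMLoc {d : ℕ} (μ : Measure (Euc d)) (n : ℕ) (f : Euc d → ℝ) (x : Euc d) : ℝ :=
  sSup {r : ℝ | ∃ φ : Euc d → ℝ, TestFunLoc μ n x φ ∧ r = |∫ y, f y * φ y ∂μ|}

/-- The Orlicz quasi-norm of `u` on the set `E`, for the Orlicz function `P`
(with value `∞` when no admissible constant exists). -/
def orliczNormOn {α : Type*} [MeasurableSpace α] (P : ℝ → ℝ) (lam : Measure α)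
    (E : Set α) (u : α → ℝ) : ℝ≥0∞ :=
  sInf {k : ℝ≥0∞ | 0 < k ∧ k ≠ ∞ ∧
    ∫⁻ x in E, ENNReal.ofReal (P (|u x| / k.toReal)) ∂lam ≤ 1}

/-- The Orlicz quasi-norm of `u`. -/
def orliczNorm {α : Type*} [MeasurableSpace α] (P : ℝ → ℝ) (lam : Measure α)
    (u : α → ℝ) : ℝ≥0∞ :=
  orliczNormOn P lam Set.univ u

/-- `℘(t) = t / log(e+t)`. -/
def wp (t : ℝ) : ℝ := t / Real.log (Real.exp 1 + t)

/-- `℘̃(t) = t · log(e+t)`. -/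
def wpDual (t : ℝ) : ℝ := t * Real.log (Real.exp 1 + t)

/-- `Ξ(t) = e^t − 1`. -/
def XiFun (t : ℝ) : ℝ := Real.exp t - 1

/-- `dν(x) = dμ(x)/log(e+|x|)`. -/
def nuMeas {d : ℕ} (μ : Measure (Euc d)) : Measure (Euc d) :=
  μ.withDensity fun x => ENNReal.ofReal (Real.log (Real.exp 1 + ‖x‖))⁻¹

/-- `dσ(x) = dμ(x)/(1+|x|)^{2n+κ}`. -/
def sigmaMeas {d : ℕ} (μ : Measure (Euc d)) (n : ℕ) (κ : ℝ) : Measure (Euc d) :=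
  μ.withDensity fun x => ENNReal.ofReal (((1 + ‖x‖) ^ (2 * (n : ℝ) + κ))⁻¹)

/-- The unit cube `m + [0,1)^d` of the lattice `ℤ^d`. -/
def latCube (d : ℕ) (m : Fin d → ℤ) : Set (Euc d) :=
  {x : Euc d | ∀ i, (m i : ℝ) ≤ x i ∧ x i < (m i : ℝ) + 1}

section CubeGeometry

variable {d : ℕ}

theorem Cube.mem_set_iff {x z : Euc d} {s : ℝ} (hs : 0 ≤ s) :
    z ∈ (Cube.mk x s).set ↔ dist z.ofLp x.ofLp ≤ s / 2 := by
  simp [Cube.set, dist_pi_le_iff (show 0 ≤ s / 2 by positivity), Real.dist_eq]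

theorem Cube.set_eq_preimage (x : Euc d) {s : ℝ} (hs : 0 ≤ s) :
    (Cube.mk x s).set = (fun z : Euc d => z.ofLp) ⁻¹' closedBall x.ofLp (s / 2) := by
  ext z
  simp [Cube.mem_set_iff hs]

theorem Cube.isClosed_set (Q : Cube d) : IsClosed Q.set := by
  have : Q.set = ⋂ i, {y : Euc d | |y i - Q.center i| ≤ Q.side / 2} := by
    ext; simp [Cube.set]
  rw [this]
  exact isClosed_iInter fun i => isClosed_le (by fun_prop) continuous_const

theorem Cube.measurableSet_set (Q : Cube d) : MeasurableSet Q.set := Q.isClosed_set.measurableSet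

theorem Cube.set_subset_set {x y : Euc d} {s t : ℝ} (hs : 0 ≤ s)
    (h : dist x.ofLp y.ofLp + s / 2 ≤ t / 2) : (Cube.mk x s).set ⊆ (Cube.mk y t).set := by
  intro z hz
  rw [Cube.mem_set_iff hs] at hz
  have h0 := dist_nonneg (x := x.ofLp) (y := y.ofLp)
  rw [Cube.mem_set_iff (by linarith)]
  linarith [dist_triangle z.ofLp x.ofLp y.ofLp]

theorem Cube.set_mono (x : Euc d) {s t : ℝ} (hs : 0 ≤ s) (h : s ≤ t) :
    (Cube.mk x s).set ⊆ (Cube.mk x t).set :=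
  Cube.set_subset_set hs (by simp; linarith)

theorem Cube.ball_subset_set (x : Euc d) (s : ℝ) :
    ball x (s / 2) ⊆ (Cube.mk x s).set := by
  intro z hz i
  have h1 : ‖(z - x) i‖ ≤ ‖z - x‖ := PiLp.norm_apply_le _ i
  have h2 : ‖z - x‖ < s / 2 := by simpa [dist_eq_norm] using hz
  simpa using h1.trans h2.le

theorem Cube.isCompact_set (x : Euc d) {s : ℝ} (hs : 0 ≤ s) : IsCompact (Cube.mk x s).set := by
  rw [Cube.set_eq_preimage x hs]
  exact ((PiLp.homeomorph 2 (fun _ : Fin d => ℝ)).isClosedEmbedding.isCompact_preimage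
    (isCompact_closedBall _ _))

variable (d) in
/-- A Besicovitch covering theorem for cubes, with the bounded overlap expressed through
measures. -/
theorem Cube.exists_besicovitch_cover : ∃ N : ℕ, 0 < N ∧
    ∀ (A : Set (Euc d)) (r : Euc d → ℝ) (R : ℝ), (∀ y ∈ A, 0 < r y) → (∀ y ∈ A, r y ≤ R) →
      ∃ t : Set (Euc d), t ⊆ A ∧ t.Countable ∧ A ⊆ ⋃ y ∈ t, (Cube.mk y (r y)).set ∧
        ∀ (ν : Measure (Euc d)) (W : Set (Euc d)), (∀ y ∈ A, (Cube.mk y (r y)).set ⊆ W) →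
          ∑' y : t, ν (Cube.mk (y : Euc d) (r y)).set ≤ N * ν W := by
  obtain ⟨N, τ, hτ, hN⟩ := HasBesicovitchCovering.no_satelliteConfig (α := Fin d → ℝ)
  refine ⟨N + 1, by omega, fun A r R hr hR => ?_⟩
  let q : Besicovitch.BallPackage A (Fin d → ℝ) :=
    { c := fun y => (y : Euc d).ofLp
      r := fun y => r y / 2
      rpos := fun y => by have := hr y y.2; positivity
      r_bound := R / 2
      r_le := fun y => by have := hR y y.2; linarith }
  obtain ⟨s, hs, hcov⟩ := Besicovitch.exist_disjoint_covering_families hτ hN q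
  have hset : ∀ y : A, (Cube.mk (y : Euc d) (r y)).set
      = (fun z : Euc d => z.ofLp) ⁻¹' closedBall (q.c y) (q.r y) :=
    fun y => Cube.set_eq_preimage _ (hr y y.2).le
  have hdisj : ∀ i, (s i).PairwiseDisjoint fun y => (Cube.mk (y : Euc d) (r y)).set := by
    intro i y hy z hz hyz
    have := hs i hy hz hyz
    simp only [Function.onFun, hset] at this ⊢
    exact this.preimage _
  have hcount : ∀ i, (s i).Countable := fun i =>
    (hs i).countable_of_nonempty_interior fun y _ => by
      refine ⟨q.c y, ball_subset_interior_closedBall (mem_ball_self (q.rpos y))⟩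
  refine ⟨⋃ i, Subtype.val '' s i, ?_, ?_, ?_, ?_⟩
  · exact iUnion_subset fun i => by rintro _ ⟨y, _, rfl⟩; exact y.2
  · exact countable_iUnion fun i => (hcount i).image _
  · intro y hy
    have := hcov ⟨⟨y, hy⟩, rfl⟩
    simp only [mem_iUnion] at this ⊢
    obtain ⟨i, j, hj, hyj⟩ := this
    refine ⟨j, ⟨i, j, hj, rfl⟩, ?_⟩
    rw [hset]
    exact ball_subset_closedBall hyj
  · intro ν W hW
    calc ∑' y : ↥(⋃ i, Subtype.val '' s i), ν (Cube.mk (y : Euc d) (r y)).set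
        ≤ ∑ i, ∑' y : ↥(Subtype.val '' s i), ν (Cube.mk (y : Euc d) (r y)).set :=
          ENNReal.tsum_iUnion_le (fun y : Euc d => ν (Cube.mk y (r y)).set) _
      _ ≤ ∑ _i : Fin N, ν W := by
          refine Finset.sum_le_sum fun i _ => ?_
          have hd : (Subtype.val '' s i).PairwiseDisjoint
              fun y : Euc d => (Cube.mk y (r y)).set := by
            rintro _ ⟨y, hy, rfl⟩ _ ⟨z, hz, rfl⟩ hyz
            exact hdisj i hy hz (fun h => hyz (congrArg _ h))
          rw [← measure_biUnion ((hcount i).image _) hd fun y _ => Cube.measurableSet_set _]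
          refine measure_mono (iUnion₂_subset ?_)
          rintro _ ⟨y, hy, rfl⟩
          exact hW y y.2
      _ ≤ _ := by
          simp only [Finset.sum_const, Finset.card_univ, Fintype.card_fin, nsmul_eq_mul]
          gcongr
          simp

end CubeGeometry

section Differentiation

variable {d : ℕ} (μ : Measure (Euc d)) [IsLocallyFiniteMeasure μ]

theorem isLocallyFiniteMeasure_map_ofLp :
    IsLocallyFiniteMeasure (μ.map (MeasurableEquiv.toLp 2 (Fin d → ℝ)).symm) := by
  refine ⟨fun x => ?_⟩
  obtain ⟨U, hU, hμU⟩ := μ.finiteAt_nhds (WithLp.toLp 2 x)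
  refine ⟨WithLp.toLp 2 ⁻¹' U, (PiLp.continuous_toLp 2 _).continuousAt hU, ?_⟩
  rwa [MeasurableEquiv.map_apply]

theorem tendsto_half_nhdsGT_zero : Tendsto (fun s : ℝ => s / 2) (𝓝[>] 0) (𝓝[>] 0) := by
  refine tendsto_nhdsWithin_iff.2 ⟨?_, ?_⟩
  · have : Tendsto (fun s : ℝ => s / 2) (𝓝 0) (𝓝 (0 / 2)) := tendsto_id.div_const 2
    simpa using this.mono_left nhdsWithin_le_nhds
  · filter_upwards [self_mem_nhdsWithin] with s hs
    exact half_pos (mem_Ioi.1 hs)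

/-- Lebesgue differentiation along centred cubes. -/
theorem ae_tendsto_cubeAvg {f : Euc d → ℝ} (hf : LocallyIntegrable f μ) :
    ∀ᵐ y ∂μ, Tendsto (fun s : ℝ => cubeAvg μ ⟨y, s⟩ f) (𝓝[>] 0) (𝓝 (f y)) := by
  let e := (MeasurableEquiv.toLp 2 (Fin d → ℝ)).symm
  have := isLocallyFiniteMeasure_map_ofLp μ
  have hf' : LocallyIntegrable (f ∘ e.symm) (μ.map e) := by
    intro x
    obtain ⟨U, hU, hfU⟩ := hf (WithLp.toLp 2 x)
    refine ⟨WithLp.toLp 2 ⁻¹' U, (PiLp.continuous_toLp 2 _).continuousAt hU, ?_⟩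
    rw [e.measurableEmbedding.integrableOn_map_iff]
    exact hfU
  have h := (Besicovitch.vitaliFamily (μ.map e)).ae_tendsto_average hf'
  rw [e.measurableEmbedding.ae_map_iff] at h
  filter_upwards [h] with y hy
  have h2 := hy.comp ((Besicovitch.tendsto_filterAt (μ.map e) (e y)))
  have h3 : Tendsto (fun s : ℝ => s / 2) (𝓝[>] 0) (𝓝[>] 0) := tendsto_half_nhdsGT_zero
  have h4 := h2.comp h3
  refine Tendsto.congr' ?_ h4
  filter_upwards [self_mem_nhdsWithin] with s hs
  have hs' : (0 : ℝ) < s := hs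
  simp only [Function.comp_apply, setAverage_eq, cubeAvg, smul_eq_mul]
  rw [e.measurableEmbedding.setIntegral_map, Cube.set_eq_preimage y hs'.le, measureReal_def, e.map_apply]
  rfl

/-- Almost every point has a finite upper density of Lebesgue measure with respect to `μ`. -/
theorem ae_exists_measure_cube_ge :
    ∀ᵐ y ∂μ, ∃ c > 0, ∀ᶠ s : ℝ in 𝓝[>] 0,
      ENNReal.ofReal (c * s ^ d) ≤ μ (Cube.mk y s).set := by
  let e := (MeasurableEquiv.toLp 2 (Fin d → ℝ)).symm
  have := isLocallyFiniteMeasure_map_ofLp μ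
  have h := Besicovitch.ae_tendsto_rnDeriv volume (μ.map e)
  have h' := Measure.rnDeriv_lt_top (volume : Measure (Fin d → ℝ)) (μ.map e)
  rw [e.measurableEmbedding.ae_map_iff] at h h'
  filter_upwards [h, h'] with y hy hy'
  obtain ⟨L, hL, hL'⟩ := ENNReal.lt_iff_exists_nnreal_btwn.1 hy'
  have hL0 : 0 < L := by exact_mod_cast (zero_le.trans_lt hL)
  refine ⟨(L : ℝ)⁻¹, by positivity, ?_⟩
  have h3 : Tendsto (fun s : ℝ => s / 2) (𝓝[>] 0) (𝓝[>] 0) := tendsto_half_nhdsGT_zero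
  filter_upwards [(hy.comp h3).eventually (gt_mem_nhds hL), self_mem_nhdsWithin] with s hs hs0
  have hs' : (0 : ℝ) < s := hs0
  simp only [Function.comp_apply] at hs
  have h5 := (ENNReal.div_le_iff_le_mul (Or.inr ENNReal.coe_ne_top)
    (Or.inr (by exact_mod_cast hL0.ne'))).1 hs.le
  rw [Real.volume_pi_closedBall _ (by positivity), e.map_apply, mul_div_cancel₀ _ two_ne_zero,
    Fintype.card_fin] at h5
  rw [Cube.set_eq_preimage y hs'.le, ENNReal.ofReal_mul (by positivity),
    ENNReal.ofReal_inv_of_pos (by exact_mod_cast hL0), ENNReal.ofReal_coe_nnreal]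
  rw [← ENNReal.div_eq_inv_mul]
  exact ENNReal.div_le_of_le_mul' h5

end Differentiation

section Growth

/-- `x` belongs to the support of `μ`. -/
def InSupp {d : ℕ} (μ : Measure (Euc d)) (x : Euc d) : Prop :=
  ∀ r : ℝ, 0 < r → 0 < μ (ball x r)

/-- The density `μ(Q(x,s)) / s^n`. -/
def cubeDensity {d : ℕ} (μ : Measure (Euc d)) (n : ℕ) (x : Euc d) (s : ℝ) : ℝ :=
  (μ (Cube.mk x s).set).toReal / s ^ n

/-- The standing assumptions: `μ` has growth of order `n` on cubes, and the doubling constant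
`β` exceeds `ρ ^ n`. -/
structure HasCubeGrowth {d : ℕ} (μ : Measure (Euc d)) (n : ℕ) (C₀ ρ β : ℝ) : Prop where
  C₀_pos : 0 < C₀
  one_lt : 1 < ρ
  pow_lt : ρ ^ n < β
  measure_le : ∀ x s, InSupp μ x → 0 < s → μ (Cube.mk x s).set ≤ ENNReal.ofReal (C₀ * s ^ n)

/-- The exponent `κ` with `ρ ^ κ = β / ρ ^ n`. -/
def growthExp (n : ℕ) (ρ β : ℝ) : ℝ := Real.log (β / ρ ^ n) / Real.log ρ

theorem sum_dyadic_rpow_le {κ s b L : ℝ} (hκ : 0 < κ) (hs : 0 < s) (hb : 0 < b) (hL : 0 ≤ L)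
    (F : Finset ℕ) (hF : ∀ k ∈ F, 2 ^ k * s ≤ L * b) :
    ∑ k ∈ F, (2 ^ k * s / b) ^ κ ≤ L ^ κ * (1 - (2⁻¹ : ℝ) ^ κ)⁻¹ := by
  have hq0 : (0 : ℝ) ≤ (2⁻¹ : ℝ) ^ κ := by positivity
  have hq1 : (2⁻¹ : ℝ) ^ κ < 1 := Real.rpow_lt_one (by norm_num) (by norm_num) hκ
  rcases F.eq_empty_or_nonempty with rfl | hne
  · have : 0 < 1 - (2⁻¹ : ℝ) ^ κ := by linarith
    simpa using by positivity
  set K := F.max' hne with hK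
  have hterm : ∀ k ∈ F, (2 ^ k * s / b) ^ κ ≤ L ^ κ * ((2⁻¹ : ℝ) ^ κ) ^ (K - k) := by
    intro k hk
    have hkK : k ≤ K := F.le_max' k hk
    have h1 := hF K (F.max'_mem hne)
    have h2 : 2 ^ k * s / b ≤ L * (2⁻¹) ^ (K - k) := by
      rw [inv_pow, div_le_iff₀ hb]
      have h3 : (2 : ℝ) ^ K = 2 ^ k * 2 ^ (K - k) := by rw [← pow_add]; congr 1; omega
      rw [h3] at h1
      have : (0 : ℝ) < 2 ^ (K - k) := by positivity
      field_simp
      linarith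
    calc (2 ^ k * s / b) ^ κ ≤ (L * (2⁻¹) ^ (K - k)) ^ κ :=
          Real.rpow_le_rpow (by positivity) h2 hκ.le
      _ = _ := by
          rw [Real.mul_rpow hL (by positivity)]
          congr 1
          rw [← Real.rpow_natCast, ← Real.rpow_mul (by norm_num), ← Real.rpow_natCast,
            ← Real.rpow_mul (by norm_num), mul_comm]
  calc ∑ k ∈ F, (2 ^ k * s / b) ^ κ ≤ ∑ k ∈ F, L ^ κ * ((2⁻¹ : ℝ) ^ κ) ^ (K - k) :=
        Finset.sum_le_sum hterm
    _ ≤ ∑ k ∈ Finset.range (K + 1), L ^ κ * ((2⁻¹ : ℝ) ^ κ) ^ (K - k) := by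
        refine Finset.sum_le_sum_of_subset_of_nonneg (fun k hk => ?_) fun _ _ _ => by positivity
        exact Finset.mem_range.2 (Nat.lt_succ_of_le (F.le_max' k hk))
    _ = L ^ κ * ∑ k ∈ Finset.range (K + 1), ((2⁻¹ : ℝ) ^ κ) ^ k := by
        rw [← Finset.mul_sum, ← Finset.sum_range_reflect (fun k => ((2⁻¹ : ℝ) ^ κ) ^ k)]
        simp
    _ ≤ _ := by
        gcongr
        rw [← tsum_geometric_of_lt_one hq0 hq1]
        exact (summable_geometric_of_lt_one hq0 hq1).sum_le_tsum _ fun _ _ => by positivity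

theorem pow_mul_side_le_of_le_NQR {d : ℕ} {Q R : Cube d} (h : Q.side ≤ R.side)
    {k : ℕ} (hk : k ∈ Finset.Icc 1 (NQR Q R)) : 2 ^ k * Q.side ≤ 2 * R.side := by
  rw [Finset.mem_Icc] at hk
  obtain ⟨j, rfl⟩ : ∃ j, k = j + 1 := ⟨k - 1, by omega⟩
  have hj : j ∉ {k : ℕ | 0 < k ∧ R.side ≤ 2 ^ k * Q.side} :=
    Nat.notMem_of_lt_sInf (by simpa [NQR] using hk.2)
  rw [pow_succ]
  rcases Nat.eq_zero_or_pos j with rfl | hj0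
  · simp; linarith
  · have : 2 ^ j * Q.side < R.side := by
      by_contra! hle
      exact hj ⟨hj0, hle⟩
    linarith

theorem InSupp.isCube {d : ℕ} {μ : Measure (Euc d)} {x : Euc d} (hx : InSupp μ x) {s : ℝ}
    (hs : 0 < s) : IsCube μ ⟨x, s⟩ := ⟨hs, hx⟩

theorem InSupp.measure_cube_pos {d : ℕ} {μ : Measure (Euc d)} {x : Euc d} (hx : InSupp μ x)
    {s : ℝ} (hs : 0 < s) : 0 < μ (Cube.mk x s).set :=
  (hx (s / 2) (by positivity)).trans_le (measure_mono (Cube.ball_subset_set x s))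

theorem measure_cube_lt_top {d : ℕ} {μ : Measure (Euc d)} [IsLocallyFiniteMeasure μ]
    (Q : Cube d) : μ Q.set < ∞ := by
  have h : Q.set ⊆ (Cube.mk Q.center |Q.side|).set := fun z hz i =>
    (hz i).trans (by simpa using div_le_div_of_nonneg_right (le_abs_self _) zero_le_two)
  exact (measure_mono h).trans_lt (Cube.isCompact_set _ (abs_nonneg _)).measure_lt_top

theorem ae_inSupp {d : ℕ} (μ : Measure (Euc d)) : ∀ᵐ x ∂μ, InSupp μ x := by
  filter_upwards [μ.support_mem_ae] with x hx r hr
  exact (Measure.mem_support_iff_forall x).1 hx _ (ball_mem_nhds x hr)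

namespace HasCubeGrowth

variable {d n : ℕ} {μ : Measure (Euc d)} {C₀ ρ β : ℝ}

theorem rho_pos (H : HasCubeGrowth μ n C₀ ρ β) : 0 < ρ := zero_lt_one.trans H.one_lt

theorem one_le_beta (H : HasCubeGrowth μ n C₀ ρ β) : 1 ≤ β :=
  (one_le_pow₀ H.one_lt.le).trans H.pow_lt.le

theorem beta_pos (H : HasCubeGrowth μ n C₀ ρ β) : 0 < β := zero_lt_one.trans_le H.one_le_beta

theorem growthExp_pos (H : HasCubeGrowth μ n C₀ ρ β) : 0 < growthExp n ρ β :=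
  div_pos (Real.log_pos ((one_lt_div (pow_pos H.rho_pos n)).2 H.pow_lt)) (Real.log_pos H.one_lt)

theorem rho_rpow_growthExp (H : HasCubeGrowth μ n C₀ ρ β) :
    ρ ^ growthExp n ρ β = β / ρ ^ n := by
  have h1 := Real.log_pos H.one_lt
  have h2 : 0 < β / ρ ^ n := div_pos H.beta_pos (pow_pos H.rho_pos n)
  rw [Real.rpow_def_of_pos H.rho_pos, growthExp, mul_div_cancel₀ _ h1.ne', Real.exp_log h2]

variable {x : Euc d}

theorem cubeDensity_le (H : HasCubeGrowth μ n C₀ ρ β) (hx : InSupp μ x) {s : ℝ} (hs : 0 < s) :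
    cubeDensity μ n x s ≤ C₀ := by
  rw [cubeDensity, div_le_iff₀ (by positivity)]
  have hC := H.C₀_pos
  exact ENNReal.toReal_le_of_le_ofReal (by positivity) (H.measure_le x s hx hs)

variable [IsLocallyFiniteMeasure μ]

theorem lt_of_not_isDoubling (H : HasCubeGrowth μ n C₀ ρ β) {s : ℝ}
    (h : ¬ IsDoubling μ ρ β ⟨x, s⟩) :
    β * (μ (Cube.mk x s).set).toReal < (μ (Cube.mk x (ρ * s)).set).toReal := by
  rw [IsDoubling, not_le] at h
  have := (ENNReal.toReal_lt_toReal (ENNReal.mul_ne_top ENNReal.ofReal_ne_top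
    (measure_cube_lt_top _).ne) (measure_cube_lt_top _).ne).2 h
  rwa [ENNReal.toReal_mul, ENNReal.toReal_ofReal H.beta_pos.le] at this

/-- In the absence of doubling cubes, the density decays geometrically towards small scales. -/
theorem cubeDensity_le_rpow (H : HasCubeGrowth μ n C₀ ρ β) (hx : InSupp μ x) {s b u : ℝ}
    (hs : 0 < s) (hb : 0 < b)
    (hnd : ∀ v, s ≤ v → v < b → ¬ IsDoubling μ ρ β ⟨x, v⟩) (hu : s ≤ u) :
    cubeDensity μ n x u ≤ C₀ * (u / b) ^ growthExp n ρ β := by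
  have hκ := H.growthExp_pos
  have hC := H.C₀_pos
  have hρ := H.rho_pos
  have triv : ∀ u, s ≤ u → b ≤ u → cubeDensity μ n x u ≤ C₀ * (u / b) ^ growthExp n ρ β := by
    intro u hu hbu
    refine (H.cubeDensity_le hx (hs.trans_le hu)).trans ?_
    exact le_mul_of_one_le_right hC.le (Real.one_le_rpow ((one_le_div hb).2 hbu) hκ.le)
  have key : ∀ j : ℕ, ∀ u, s ≤ u → b ≤ ρ ^ j * u →
      cubeDensity μ n x u ≤ C₀ * (u / b) ^ growthExp n ρ β := by
    intro j
    induction j with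
    | zero => intro u hu hbu; exact triv u hu (by simpa using hbu)
    | succ j ih =>
      intro u hu hbu
      rcases le_or_gt b u with h | h
      · exact triv u hu h
      have hu0 : 0 < u := hs.trans_le hu
      have h1 := ih (ρ * u) (hu.trans (le_mul_of_one_le_left hu0.le H.one_lt.le))
        (by rw [pow_succ] at hbu; linarith)
      have h2 := H.lt_of_not_isDoubling (hnd u hu h)
      rw [mul_div_assoc, Real.mul_rpow hρ.le (by positivity), H.rho_rpow_growthExp] at h1
      unfold cubeDensity at h1 ⊢
      have h3 : β / ρ ^ n * ((μ (Cube.mk x u).set).toReal / u ^ n)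
          ≤ (μ (Cube.mk x (ρ * u)).set).toReal / (ρ * u) ^ n := by
        rw [mul_pow, div_mul_div_comm]
        gcongr
      have h4 := h3.trans h1
      have h5 : 0 < β / ρ ^ n := div_pos H.beta_pos (pow_pos hρ n)
      refine le_of_mul_le_mul_left ?_ h5
      linarith
  have hu0 : 0 < u := hs.trans_le hu
  obtain ⟨j, hj⟩ := pow_unbounded_of_one_lt (b / u) H.one_lt
  exact key j u hu (by rw [div_lt_iff₀ hu0] at hj; exact hj.le)

theorem exists_next_doubling (H : HasCubeGrowth μ n C₀ ρ β) (hx : InSupp μ x) {s : ℝ}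
    (hs : 0 < s) : ∃ r, s ≤ r ∧ IsDoubling μ ρ β ⟨x, r⟩ ∧
      ∀ v, s ≤ v → v < r / 2 → ¬ IsDoubling μ ρ β ⟨x, v⟩ := by
  set D := {r : ℝ | s ≤ r ∧ IsDoubling μ ρ β ⟨x, r⟩} with hD
  have hbdd : BddBelow D := ⟨s, fun r hr => hr.1⟩
  have hne : D.Nonempty := by
    by_contra hempty
    rw [not_nonempty_iff_eq_empty] at hempty
    have hpos : 0 < cubeDensity μ n x s :=
      div_pos (ENNReal.toReal_pos (hx.measure_cube_pos hs).ne' (measure_cube_lt_top _).ne)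
        (by positivity)
    have hle : ∀ᶠ b : ℝ in atTop, cubeDensity μ n x s ≤ C₀ * (s / b) ^ growthExp n ρ β := by
      filter_upwards [eventually_gt_atTop 0] with b hb
      refine H.cubeDensity_le_rpow hx hs hb (fun v hv _ hdbl => ?_) le_rfl
      have : v ∈ D := ⟨hv, hdbl⟩
      simp [hempty] at this
    have hlim : Tendsto (fun b : ℝ => C₀ * (s / b) ^ growthExp n ρ β) atTop (𝓝 0) := by
      have h1 : Tendsto (fun b : ℝ => s / b) atTop (𝓝 0) := tendsto_const_nhds.div_atTop tendsto_id
      have h2 := (h1.rpow_const (p := growthExp n ρ β) (Or.inr H.growthExp_pos.le)).const_mul C₀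
      simpa [Real.zero_rpow H.growthExp_pos.ne'] using h2
    exact hpos.not_ge (ge_of_tendsto hlim hle)
  have hinf : 0 < sInf D := hs.trans_le (le_csInf hne fun r hr => hr.1)
  obtain ⟨r, hr, hr2⟩ := exists_lt_of_csInf_lt hne (show sInf D < 2 * sInf D by linarith)
  refine ⟨r, hr.1, hr.2, fun v hv hvr hdbl => ?_⟩
  have := csInf_le hbdd (show v ∈ D from ⟨hv, hdbl⟩)
  linarith

end HasCubeGrowth

end Growth

section LocalOscillation

theorem sum_two_dyadic_ranges_le {κ s m b₁ b₂ L A : ℝ} (hκ : 0 < κ) (hs : 0 < s) (hb₁ : 0 < b₁)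
    (hb₂ : 0 < b₂) (hL : 0 ≤ L) (hA : 0 ≤ A) (F : Finset ℕ) (φ : ℕ → ℝ) (hm : m ≤ L * b₁)
    (hF : ∀ k ∈ F, 2 ^ k * s ≤ L * b₂)
    (h₁ : ∀ k ∈ F, 2 ^ k * s ≤ m → φ k ≤ A * (2 ^ k * s / b₁) ^ κ)
    (h₂ : ∀ k ∈ F, m < 2 ^ k * s → φ k ≤ A * (2 ^ k * s / b₂) ^ κ) :
    ∑ k ∈ F, φ k ≤ 2 * (A * (L ^ κ * (1 - (2⁻¹ : ℝ) ^ κ)⁻¹)) := by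
  rw [← Finset.sum_filter_add_sum_filter_not F (fun k => 2 ^ k * s ≤ m), two_mul]
  refine add_le_add ?_ ?_
  · refine (Finset.sum_le_sum (g := fun k => A * (2 ^ k * s / b₁) ^ κ) fun k hk => ?_).trans ?_
    · exact h₁ k (Finset.mem_filter.1 hk).1 (Finset.mem_filter.1 hk).2
    · rw [← Finset.mul_sum]
      gcongr
      exact sum_dyadic_rpow_le hκ hs hb₁ hL _ fun k hk => (Finset.mem_filter.1 hk).2.trans hm
  · refine (Finset.sum_le_sum (g := fun k => A * (2 ^ k * s / b₂) ^ κ) fun k hk => ?_).trans ?_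
    · exact h₂ k (Finset.mem_filter.1 hk).1 (not_le.1 (Finset.mem_filter.1 hk).2)
    · rw [← Finset.mul_sum]
      gcongr
      exact sum_dyadic_rpow_le hκ hs hb₂ hL _ fun k hk => hF k (Finset.mem_filter.1 hk).1

/-- `f` satisfies the `rbmo` conditions with constant `M > 0`, in the standing setting. -/
structure HasRbmoBound {d : ℕ} (μ : Measure (Euc d)) (n : ℕ) (C₀ η ρ β : ℝ) (f : Euc d → ℝ)
    (M : ℝ) : Prop where
  growth : HasCubeGrowth μ n C₀ ρ β
  one_lt_eta : 1 < η
  eta_le : η ≤ ρ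
  pos : 0 < M
  locallyIntegrable : LocallyIntegrable f μ
  bound : RbmoLocBound μ n η ρ β f M

/-- A bound for the Tolsa coefficients of the pairs of cubes which are compared below. -/
def coeffBound (n : ℕ) (C₀ ρ β L : ℝ) : ℝ :=
  1 + 2 * (2 ^ n * C₀ * (L ^ growthExp n ρ β * (1 - (2⁻¹ : ℝ) ^ growthExp n ρ β)⁻¹))

theorem HasCubeGrowth.one_le_coeffBound {d n : ℕ} {μ : Measure (Euc d)} {C₀ ρ β L : ℝ}
    (H : HasCubeGrowth μ n C₀ ρ β) (hL : 0 ≤ L) : 1 ≤ coeffBound n C₀ ρ β L := by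
  have hq1 : (2⁻¹ : ℝ) ^ growthExp n ρ β < 1 :=
    Real.rpow_lt_one (by norm_num) (by norm_num) H.growthExp_pos
  have h1 : 0 < 1 - (2⁻¹ : ℝ) ^ growthExp n ρ β := by linarith
  have := H.C₀_pos
  rw [coeffBound]
  have : 0 ≤ 2 ^ n * C₀ * (L ^ growthExp n ρ β * (1 - (2⁻¹ : ℝ) ^ growthExp n ρ β)⁻¹) := by
    positivity
  linarith

namespace HasRbmoBound

variable {d n : ℕ} {μ : Measure (Euc d)} {C₀ η ρ β M : ℝ} {f : Euc d → ℝ} {x y : Euc d}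

theorem tilde_eq_self {Q : Cube d} (h : IsDoubling μ ρ β Q) : tilde μ ρ β Q = Q := by
  have h0 : sInf {N : ℕ | IsDoubling μ ρ β (Q.dilate (2 ^ N))} = 0 :=
    Nat.sInf_eq_zero.2 (Or.inl (by simpa [Cube.dilate] using h))
  rw [tilde, h0]
  simp [Cube.dilate]

theorem SQR_eq (s : ℝ) (R : Cube d) : SQR μ n ⟨x, s⟩ R
    = 1 + ∑ k ∈ Finset.Icc 1 (NQR ⟨x, s⟩ R), cubeDensity μ n x (2 ^ k * s) := rfl

theorem integrableOn_cube (h : HasRbmoBound μ n C₀ η ρ β f M) (Q : Cube d) :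
    IntegrableOn f Q.set μ := by
  have h1 : Q.set ⊆ (Cube.mk Q.center |Q.side|).set := fun z hz i =>
    (hz i).trans (by simpa using div_le_div_of_nonneg_right (le_abs_self _) zero_le_two)
  exact (h.locallyIntegrable.integrableOn_isCompact
    (Cube.isCompact_set _ (abs_nonneg _))).mono_set h1

variable [IsLocallyFiniteMeasure μ]

theorem measure_eta_le (h : HasRbmoBound μ n C₀ η ρ β f M) {r : ℝ} (hr : 0 < r)
    (hd : IsDoubling μ ρ β ⟨y, r⟩) :
    (μ (Cube.mk y (η * r)).set).toReal ≤ β * (μ (Cube.mk y r).set).toReal := by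
  have hη : 0 < η := zero_lt_one.trans h.one_lt_eta
  have h1 : μ (Cube.mk y (η * r)).set ≤ ENNReal.ofReal β * μ (Cube.mk y r).set :=
    (measure_mono (Cube.set_mono y (by positivity)
      (mul_le_mul_of_nonneg_right h.eta_le hr.le))).trans hd
  have h2 := ENNReal.toReal_mono (ENNReal.mul_ne_top ENNReal.ofReal_ne_top
    (measure_cube_lt_top _).ne) h1
  rwa [ENNReal.toReal_mul, ENNReal.toReal_ofReal h.growth.beta_pos.le] at h2

theorem lintegral_sub_avg_le (h : HasRbmoBound μ n C₀ η ρ β f M) (hy : InSupp μ y) {r : ℝ}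
    (hr : 0 < r) (hr1 : r ≤ 1) (hd : IsDoubling μ ρ β ⟨y, r⟩) :
    ∫⁻ x in (Cube.mk y r).set, ‖f x - cubeAvg μ ⟨y, r⟩ f‖ₑ ∂μ
      ≤ ENNReal.ofReal (β * M) * μ (Cube.mk y r).set := by
  have h1 := h.bound.1 ⟨y, r⟩ (hy.isCube hr) hr1
  rw [tilde_eq_self hd] at h1
  have hint : IntegrableOn (fun x => f x - cubeAvg μ ⟨y, r⟩ f) (Cube.mk y r).set μ :=
    (h.integrableOn_cube _).sub (integrableOn_const (measure_cube_lt_top _).ne)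
  have h2 := h.measure_eta_le hr hd
  have h3 : ∫ x in (Cube.mk y r).set, |f x - cubeAvg μ ⟨y, r⟩ f| ∂μ
      ≤ β * M * (μ (Cube.mk y r).set).toReal := by
    refine h1.trans ?_
    calc _ ≤ M * (β * (μ (Cube.mk y r).set).toReal) := by
          gcongr
          · exact h.pos.le
          · exact h2
      _ = _ := by ring
  rw [← ofReal_integral_norm_eq_lintegral_enorm hint,
    ← ENNReal.ofReal_toReal (measure_cube_lt_top (μ := μ) ⟨y, r⟩).ne,
    ← ENNReal.ofReal_mul (mul_nonneg h.growth.beta_pos.le h.pos.le)]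
  exact ENNReal.ofReal_le_ofReal h3

theorem abs_avg_le (h : HasRbmoBound μ n C₀ η ρ β f M) (hy : InSupp μ y) {r : ℝ}
    (hr : 1 < r) (hd : IsDoubling μ ρ β ⟨y, r⟩) : |cubeAvg μ ⟨y, r⟩ f| ≤ β * M := by
  have hr0 : 0 < r := zero_lt_one.trans hr
  have h1 := h.bound.2.2 ⟨y, r⟩ (hy.isCube hr0) hr
  have h2 := h.measure_eta_le hr0 hd
  have hpos : 0 < (μ (Cube.mk y r).set).toReal :=
    ENNReal.toReal_pos (hy.measure_cube_pos hr0).ne' (measure_cube_lt_top _).ne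
  rw [cubeAvg, abs_mul, abs_inv, abs_of_pos hpos, inv_mul_le_iff₀ hpos]
  calc _ ≤ ∫ x in (Cube.mk y r).set, |f x| ∂μ := abs_integral_le_integral_abs
    _ ≤ M * (β * (μ (Cube.mk y r).set).toReal) := h1.trans (mul_le_mul_of_nonneg_left h2 h.pos.le)
    _ = _ := by ring

/-- Averages over consecutive concentric doubling cubes are comparable. -/
theorem abs_avg_sub_next_le (h : HasRbmoBound μ n C₀ η ρ β f M) (hy : InSupp μ y) {r t : ℝ}
    (hr : 0 < r) (hr1 : r ≤ 1) (hrt : 2 * r ≤ t) (hd : IsDoubling μ ρ β ⟨y, r⟩)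
    (hdt : IsDoubling μ ρ β ⟨y, t⟩)
    (hnd : ∀ v, 2 * r ≤ v → v < t / 2 → ¬ IsDoubling μ ρ β ⟨y, v⟩) :
    |cubeAvg μ ⟨y, r⟩ f - cubeAvg μ ⟨y, t⟩ f| ≤ M * coeffBound n C₀ ρ β 4 := by
  have hκ := h.growth.growthExp_pos
  have hC := h.growth.C₀_pos
  have ht0 : 0 < t := by linarith
  refine (h.bound.2.1 _ _ (hy.isCube hr) (hy.isCube (by linarith)) hr1
    (Cube.set_mono y hr.le (by linarith)) hd hdt).trans ?_
  refine mul_le_mul_of_nonneg_left ?_ h.pos.le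
  rw [SQR_eq, coeffBound]
  gcongr
  refine sum_two_dyadic_ranges_le (m := 2 * t) (b₁ := t / 2) (b₂ := t / 2) hκ hr (by linarith)
    (by linarith) (by norm_num) (by positivity) _ _ (by linarith) ?_ ?_ ?_
  · intro k hk
    have := pow_mul_side_le_of_le_NQR (Q := ⟨y, r⟩) (R := ⟨y, t⟩) (show r ≤ t by linarith) hk
    simp only at this
    linarith
  all_goals
    intro k hk _
    have hk1 := (Finset.mem_Icc.1 hk).1
    have h2k : (2 : ℝ) ≤ 2 ^ k := le_self_pow₀ one_le_two (by omega)
    refine (h.growth.cubeDensity_le_rpow hy (show 0 < 2 * r by positivity)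
      (show 0 < t / 2 by linarith) hnd (by gcongr)).trans ?_
    gcongr
    exact le_mul_of_one_le_left hC.le (one_le_pow₀ one_le_two)

/-- The average over a doubling cube with a nearby centre, whose side is essentially the smallest
possible beyond a given scale, is comparable to the average over the given doubling cube. -/
theorem abs_avg_sub_avg_le (h : HasRbmoBound μ n C₀ η ρ β f M) (hx : InSupp μ x)
    (hy : InSupp μ y) {l ε r : ℝ} (hl : 0 < l) (hl1 : l ≤ 1) (hε : 0 < ε) (hε1 : ε ≤ 1)
    (hdist : dist x.ofLp y.ofLp ≤ l) (hdx : IsDoubling μ ρ β ⟨x, l⟩)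
    (hr : ε * l ≤ r) (hdr : IsDoubling μ ρ β ⟨y, r⟩)
    (hnd : ∀ v, 2 * (ε * l) ≤ v → v < r / 2 → ¬ IsDoubling μ ρ β ⟨y, v⟩) :
    |cubeAvg μ ⟨y, r⟩ f - cubeAvg μ ⟨x, l⟩ f| ≤ (2 * coeffBound n C₀ ρ β (8 / ε) + 2 * β) * M := by
  have hκ := h.growth.growthExp_pos
  have hC := h.growth.C₀_pos
  have hβ := h.growth.beta_pos
  have hM := h.pos
  have hεl : 0 < ε * l := by positivity
  have hr0 : 0 < r := hεl.trans_le hr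
  have hL : 8 ≤ 8 / ε := (le_div_iff₀ hε).2 (by linarith)
  have hL0 : 0 ≤ 8 / ε := by linarith
  have hlr : l ≤ r / ε := (le_div_iff₀ hε).2 (by linarith)
  have hrr : r ≤ r / ε := (le_div_iff₀ hε).2 (by nlinarith)
  have h8r : 8 / ε * r = 8 * (r / ε) := by ring
  obtain ⟨t, hmt, hdt, hndt⟩ := h.growth.exists_next_doubling hy
    (show 0 < max (2 * r) (4 * l) by positivity)
  set m := max (2 * r) (4 * l) with hm
  have hm2 : 2 * r ≤ m := le_max_left _ _
  have hm4 : 4 * l ≤ m := le_max_right _ _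
  have hmL : m ≤ 4 * (r / ε) := max_le (by linarith) (by linarith)
  have ht0 : 0 < t := by linarith
  have hcoef := h.growth.one_le_coeffBound hL0
  have hxt : |cubeAvg μ ⟨x, l⟩ f - cubeAvg μ ⟨y, t⟩ f| ≤ M * coeffBound n C₀ ρ β (8 / ε) := by
    refine (h.bound.2.1 _ _ (hx.isCube hl) (hy.isCube ht0) hl1
      (Cube.set_subset_set hl.le (by linarith)) hdx hdt).trans ?_
    refine mul_le_mul_of_nonneg_left ?_ h.pos.le
    rw [SQR_eq, coeffBound]
    gcongr
    have hdens : ∀ k ∈ Finset.Icc 1 (NQR ⟨x, l⟩ ⟨y, t⟩),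
        cubeDensity μ n x (2 ^ k * l) ≤ 2 ^ n * cubeDensity μ n y (2 ^ k * (2 * l)) := by
      intro k hk
      have hk1 := (Finset.mem_Icc.1 hk).1
      have h2k : (2 : ℝ) ≤ 2 ^ k := le_self_pow₀ one_le_two (by omega)
      have hsub : (Cube.mk x (2 ^ k * l)).set ⊆ (Cube.mk y (2 ^ k * (2 * l))).set :=
        Cube.set_subset_set (by positivity) (by nlinarith)
      have h1 := ENNReal.toReal_mono (measure_cube_lt_top (μ := μ) _).ne (measure_mono hsub)
      rw [cubeDensity, cubeDensity]
      calc _ ≤ (μ (Cube.mk y (2 ^ k * (2 * l))).set).toReal / (2 ^ k * l) ^ n := by gcongr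
        _ = _ := by
          rw [show 2 ^ k * (2 * l) = 2 * (2 ^ k * l) by ring, mul_pow 2 (2 ^ k * l)]
          field_simp
    refine sum_two_dyadic_ranges_le (m := m) (b₁ := r / 2) (b₂ := t / 2) (s := 2 * l) hκ
      (by positivity) (by linarith) (by linarith) (by positivity) (by positivity) _ _
      (by linarith) ?_ ?_ ?_
    · intro k hk
      have := pow_mul_side_le_of_le_NQR (Q := ⟨x, l⟩) (R := ⟨y, t⟩) (show l ≤ t by linarith) hk
      simp only at this
      nlinarith
    · intro k hk hkm
      have hk1 := (Finset.mem_Icc.1 hk).1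
      have h2k : (2 : ℝ) ≤ 2 ^ k := le_self_pow₀ one_le_two (by omega)
      refine (hdens k hk).trans ?_
      rw [mul_assoc (2 ^ n : ℝ)]
      gcongr
      exact h.growth.cubeDensity_le_rpow hy (show 0 < 2 * (ε * l) by positivity)
        (show 0 < r / 2 by linarith) hnd (by nlinarith)
    · intro k hk hkm
      refine (hdens k hk).trans ?_
      rw [mul_assoc (2 ^ n : ℝ)]
      gcongr
      exact h.growth.cubeDensity_le_rpow hy (show 0 < m by linarith)
        (show 0 < t / 2 by linarith) hndt hkm.le
  have hyt : |cubeAvg μ ⟨y, r⟩ f - cubeAvg μ ⟨y, t⟩ f|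
      ≤ M * (coeffBound n C₀ ρ β (8 / ε) + 2 * β) := by
    rcases le_or_gt r 1 with hr1 | hr1
    · refine (h.bound.2.1 _ _ (hy.isCube hr0) (hy.isCube ht0) hr1
        (Cube.set_mono y hr0.le (by linarith)) hdr hdt).trans ?_
      refine mul_le_mul_of_nonneg_left ?_ h.pos.le
      refine le_trans ?_ (show coeffBound n C₀ ρ β (8 / ε) ≤ _ by linarith)
      rw [SQR_eq, coeffBound]
      gcongr
      have hCn : C₀ ≤ 2 ^ n * C₀ := le_mul_of_one_le_left hC.le (one_le_pow₀ one_le_two)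
      refine sum_two_dyadic_ranges_le (m := m) (b₁ := r) (b₂ := t / 2) hκ
        hr0 hr0 (by linarith) (by positivity) (by positivity) _ _
        (by linarith) ?_ ?_ ?_
      · intro k hk
        have := pow_mul_side_le_of_le_NQR (Q := ⟨y, r⟩) (R := ⟨y, t⟩) (show r ≤ t by linarith) hk
        simp only at this
        nlinarith
      · intro k hk hkm
        have h2k : (1 : ℝ) ≤ 2 ^ k := one_le_pow₀ one_le_two
        refine (h.growth.cubeDensity_le hy (by positivity)).trans (hCn.trans ?_)
        refine le_mul_of_one_le_right (by positivity) (Real.one_le_rpow ?_ hκ.le)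
        rwa [mul_div_assoc, div_self hr0.ne', mul_one]
      · intro k hk hkm
        refine (h.growth.cubeDensity_le_rpow hy (show 0 < m by linarith)
          (show 0 < t / 2 by linarith) hndt hkm.le).trans ?_
        gcongr
    · have h1 := h.abs_avg_le hy hr1 hdr
      have h2 := h.abs_avg_le hy (show 1 < t by linarith) hdt
      have h3 := abs_sub (cubeAvg μ ⟨y, r⟩ f) (cubeAvg μ ⟨y, t⟩ f)
      nlinarith
  have h3 := abs_sub_le (cubeAvg μ ⟨y, r⟩ f) (cubeAvg μ ⟨y, t⟩ f) (cubeAvg μ ⟨x, l⟩ f)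
  rw [abs_sub_comm (cubeAvg μ ⟨y, t⟩ f)] at h3
  linarith

end HasRbmoBound

end LocalOscillation

section StoppingCubes

/-- The average of `f` is close to `f y` on some doubling cube centred at `y` inside any given
doubling cube centred at `y`. -/
def IsApproxPoint {d : ℕ} (μ : Measure (Euc d)) (ρ β : ℝ) (f : Euc d → ℝ) (D : ℝ)
    (y : Euc d) : Prop :=
  InSupp μ y ∧ ∀ r, 0 < r → IsDoubling μ ρ β ⟨y, r⟩ →
    ∃ r', 0 < r' ∧ r' ≤ r ∧ IsDoubling μ ρ β ⟨y, r'⟩ ∧ |f y - cubeAvg μ ⟨y, r'⟩ f| ≤ D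

/-- The constant in the approximation of `f y` by averages over doubling cubes. -/
def approxBound (d : ℕ) (η : ℝ) : ℝ := 1 + 2 ^ (⌈η⌉₊ * (d + 1))

theorem tendsto_div_two_pow_nhdsGT {r : ℝ} (hr : 0 < r) :
    Tendsto (fun j : ℕ => r / 2 ^ j) atTop (𝓝[>] 0) := by
  refine tendsto_nhdsWithin_iff.2 ⟨?_, Eventually.of_forall fun j => by simp; positivity⟩
  exact tendsto_const_nhds.div_atTop (tendsto_pow_atTop_atTop_of_one_lt one_lt_two)

variable {d n : ℕ} {μ : Measure (Euc d)} {C₀ η ρ β M : ℝ} {f : Euc d → ℝ} {x y : Euc d}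

/-- A point with positive lower `d`-density is the centre of small dyadic dilates of a cube which
are doubling with respect to the factor `2 ^ p`. -/
theorem exists_dyadic_doubling [IsLocallyFiniteMeasure μ] {c : ℝ} (hc : 0 < c)
    (hy : ∀ᶠ s : ℝ in 𝓝[>] 0, ENNReal.ofReal (c * s ^ d) ≤ μ (Cube.mk y s).set)
    {P : ℝ → Prop} (hP : ∀ᶠ s in 𝓝[>] 0, P s) {p : ℕ} (hp : 0 < p) {r : ℝ} (hr : 0 < r) :
    ∃ j : ℕ, P (r / 2 ^ j) ∧ (μ (Cube.mk y (2 ^ p * (r / 2 ^ j))).set).toReal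
      ≤ 2 ^ (p * (d + 1)) * (μ (Cube.mk y (r / 2 ^ j)).set).toReal := by
  obtain ⟨J, hJ⟩ := eventually_atTop.1 ((tendsto_div_two_pow_nhdsGT hr).eventually (hy.and hP))
  by_contra! hcon
  set a : ℕ → ℝ := fun j => (μ (Cube.mk y (r / 2 ^ j)).set).toReal with ha
  have hstep : ∀ i : ℕ, (2 ^ (p * (d + 1))) ^ i * a (J + p * i) ≤ a J := by
    intro i
    induction i with
    | zero => simp
    | succ i ih =>
      have h1 := hcon (J + p * (i + 1)) (hJ _ (by omega)).2
      have h2 : (2 : ℝ) ^ p * (r / 2 ^ (J + p * (i + 1))) = r / 2 ^ (J + p * i) := by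
        rw [show J + p * (i + 1) = p + (J + p * i) by ring, pow_add]
        field_simp
      rw [h2] at h1
      refine le_trans ?_ ih
      rw [pow_succ, mul_assoc]
      gcongr
  have hlow : ∀ i : ℕ, c * (r / 2 ^ J) ^ d * 2 ^ i ≤ a J := by
    intro i
    have h1 : c * (r / 2 ^ (J + p * i)) ^ d ≤ a (J + p * i) :=
      (ENNReal.ofReal_le_iff_le_toReal (measure_cube_lt_top _).ne).1 (hJ _ (by omega)).1
    refine le_trans ?_ ((mul_le_mul_of_nonneg_left h1 (by positivity)).trans (hstep i))
    have h2 : ((2 : ℝ) ^ (p * (d + 1))) ^ i * (c * (r / 2 ^ (J + p * i)) ^ d)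
        = c * (r / 2 ^ J) ^ d * 2 ^ (p * i) := by
      rw [pow_add, div_pow, div_pow, mul_pow, ← pow_mul, ← pow_mul, ← pow_mul,
        show p * (d + 1) * i = p * i * d + p * i by ring, pow_add]
      field_simp
    rw [h2]
    gcongr
    · exact one_le_two
    · exact Nat.le_mul_of_pos_left i hp
  have hpos : 0 < c * (r / 2 ^ J) ^ d := by positivity
  obtain ⟨i, hi⟩ := pow_unbounded_of_one_lt (a J / (c * (r / 2 ^ J) ^ d)) one_lt_two
  rw [div_lt_iff₀ hpos] at hi
  linarith [hlow i]

namespace HasRbmoBound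

variable [IsLocallyFiniteMeasure μ]

theorem abs_avg_sub_avg_tilde_le (h : HasRbmoBound μ n C₀ η ρ β f M) (hy : InSupp μ y) {s K : ℝ}
    (hs : 0 < s) (hs1 : s ≤ 1)
    (hK : (μ (Cube.mk y (η * s)).set).toReal ≤ K * (μ (Cube.mk y s).set).toReal) :
    |cubeAvg μ ⟨y, s⟩ f - cubeAvg μ (tilde μ ρ β ⟨y, s⟩) f| ≤ K * M := by
  have h1 := h.bound.1 ⟨y, s⟩ (hy.isCube hs) hs1
  set b := cubeAvg μ (tilde μ ρ β ⟨y, s⟩) f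
  have hpos : 0 < (μ (Cube.mk y s).set).toReal :=
    ENNReal.toReal_pos (hy.measure_cube_pos hs).ne' (measure_cube_lt_top _).ne
  have h2 : cubeAvg μ ⟨y, s⟩ f - b
      = (μ (Cube.mk y s).set).toReal⁻¹ * ∫ x in (Cube.mk y s).set, (f x - b) ∂μ := by
    rw [integral_sub (h.integrableOn_cube _) (integrableOn_const (measure_cube_lt_top _).ne),
      setIntegral_const, cubeAvg, measureReal_def, smul_eq_mul]
    field_simp
  rw [h2, abs_mul, abs_inv, abs_of_pos hpos, inv_mul_le_iff₀ hpos]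
  calc _ ≤ ∫ x in (Cube.mk y s).set, |f x - b| ∂μ := abs_integral_le_integral_abs
    _ ≤ M * (K * (μ (Cube.mk y s).set).toReal) := h1.trans (mul_le_mul_of_nonneg_left hK h.pos.le)
    _ = _ := by ring

theorem ae_isApproxPoint (h : HasRbmoBound μ n C₀ η ρ β f M) :
    ∀ᵐ y ∂μ, IsApproxPoint μ ρ β f (approxBound d η * M) y := by
  filter_upwards [ae_inSupp μ, ae_tendsto_cubeAvg μ h.locallyIntegrable,
    ae_exists_measure_cube_ge μ] with y hy hlim hc
  obtain ⟨c, hc, hlow⟩ := hc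
  refine ⟨hy, fun r hr hd => ?_⟩
  have hM := h.pos
  have hη : 0 < η := zero_lt_one.trans h.one_lt_eta
  have hP : ∀ᶠ s : ℝ in 𝓝[>] 0, s ≤ 1 ∧ |cubeAvg μ ⟨y, s⟩ f - f y| ≤ M := by
    refine (eventually_nhdsWithin_of_eventually_nhds (eventually_le_nhds zero_lt_one)).and ?_
    filter_upwards [(Metric.tendsto_nhds.1 hlim) M hM] with s hs
    exact hs.le
  obtain ⟨j, ⟨hj1, hjM⟩, hjd⟩ := exists_dyadic_doubling hc hlow hP (Nat.ceil_pos.2 hη) hr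
  set s := r / 2 ^ j with hs
  have hs0 : 0 < s := by positivity
  have hηp : η ≤ 2 ^ ⌈η⌉₊ := (Nat.le_ceil η).trans (by exact_mod_cast Nat.lt_two_pow_self.le)
  have hK : (μ (Cube.mk y (η * s)).set).toReal
      ≤ 2 ^ (⌈η⌉₊ * (d + 1)) * (μ (Cube.mk y s).set).toReal :=
    (ENNReal.toReal_mono (measure_cube_lt_top _).ne (measure_mono (Cube.set_mono y
      (by positivity) (by gcongr)))).trans hjd
  have h1 := h.abs_avg_sub_avg_tilde_le hy hs0 hj1 hK
  set D := {N : ℕ | IsDoubling μ ρ β ((Cube.mk y s).dilate (2 ^ N))} with hD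
  have hjs : 2 ^ j * s = r := by rw [hs]; field_simp
  have hjD : j ∈ D := by simpa [hD, Cube.dilate, hjs] using hd
  refine ⟨2 ^ sInf D * s, by positivity, ?_, Nat.sInf_mem ⟨j, hjD⟩, ?_⟩
  · rw [← hjs]
    gcongr
    · exact one_le_two
    · exact Nat.sInf_le hjD
  · have h2 := abs_sub_le (f y) (cubeAvg μ ⟨y, s⟩ f) (cubeAvg μ (tilde μ ρ β ⟨y, s⟩) f)
    rw [abs_sub_comm] at hjM
    refine h2.trans ?_
    rw [approxBound, add_mul, one_mul]
    exact add_le_add hjM h1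

/-- Either `f y` is close to `a`, or `y` is the centre of a small doubling cube on which the average
of `f` deviates from `a` by a controlled amount. -/
theorem abs_sub_le_or_exists_stopping (h : HasRbmoBound μ n C₀ η ρ β f M) {D l a T C₁ : ℝ}
    (hy : IsApproxPoint μ ρ β f (D * M) y) (hl : 0 < l) (hl1 : l ≤ 1)
    (hC₁ : ∀ r, l ≤ r → IsDoubling μ ρ β ⟨y, r⟩ →
      (∀ v, 2 * l ≤ v → v < r / 2 → ¬ IsDoubling μ ρ β ⟨y, v⟩) →
      |cubeAvg μ ⟨y, r⟩ f - a| ≤ C₁ * M) (hT : 0 ≤ T) (hC₁0 : 0 ≤ C₁) :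
    |f y - a| ≤ (T + C₁ + D) * M ∨ ∃ r, 0 < r ∧ r ≤ l ∧ IsDoubling μ ρ β ⟨y, r⟩ ∧
      T * M < |cubeAvg μ ⟨y, r⟩ f - a| ∧
      |cubeAvg μ ⟨y, r⟩ f - a| ≤ (T + C₁ + coeffBound n C₀ ρ β 4) * M := by
  have hM := h.pos
  have hTM : 0 ≤ T * M := by positivity
  have hCM : 0 ≤ C₁ * M := by positivity
  obtain ⟨hsupp, happ⟩ := hy
  obtain ⟨r₀, hr₀, hd₀, hnd₀⟩ := h.growth.exists_next_doubling hsupp hl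
  obtain ⟨r', hr', hr'₀, hd', hf'⟩ := happ r₀ (hl.trans_le hr₀) hd₀
  have htri := abs_sub_le (f y) (cubeAvg μ ⟨y, r'⟩ f) a
  rcases le_or_gt l r' with hlr | hlr
  · left
    have := hC₁ r' hlr hd' fun v hv hvr => hnd₀ v (by linarith) (by linarith)
    linarith
  rcases le_or_gt (|cubeAvg μ ⟨y, r'⟩ f - a|) (T * M) with hle | hgt
  · left
    linarith
  right
  set A := {r : ℝ | r ≤ l ∧ IsDoubling μ ρ β ⟨y, r⟩ ∧ T * M < |cubeAvg μ ⟨y, r⟩ f - a|} with hA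
  have hr'A : r' ∈ A := ⟨hlr.le, hd', hgt⟩
  have hbdd : BddAbove A := ⟨l, fun r hr => hr.1⟩
  have hsup : r' ≤ sSup A := le_csSup hbdd hr'A
  obtain ⟨r, hrA, hr⟩ := exists_lt_of_lt_csSup ⟨r', hr'A⟩ (show sSup A / 2 < sSup A by linarith)
  have hr0 : 0 < r := by linarith
  refine ⟨r, hr0, hrA.1, hrA.2.1, hrA.2.2, ?_⟩
  obtain ⟨t, hrt, hdt, hndt⟩ := h.growth.exists_next_doubling hsupp (show 0 < 2 * r by positivity)
  have h1 := h.abs_avg_sub_next_le hsupp hr0 (hrA.1.trans hl1) hrt hrA.2.1 hdt hndt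
  have h2 := abs_sub_le (cubeAvg μ ⟨y, r⟩ f) (cubeAvg μ ⟨y, t⟩ f) a
  rcases le_or_gt t l with htl | htl
  · have h3 : |cubeAvg μ ⟨y, t⟩ f - a| ≤ T * M := by
      by_contra! hlt
      have := le_csSup hbdd (show t ∈ A from ⟨htl, hdt, hlt⟩)
      linarith
    linarith
  · have h3 := hC₁ t htl.le hdt fun v hv hvt => hndt v (by linarith [hrA.1]) hvt
    linarith

end HasRbmoBound

variable (d) in
/-- An overlap constant in the Besicovitch covering theorem for cubes. -/
def overlapBound : ℕ := (Cube.exists_besicovitch_cover d).choose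

theorem overlapBound_pos : 0 < overlapBound d := (Cube.exists_besicovitch_cover d).choose_spec.1

/-- A countable family of stopping cubes with centres `t` and side lengths `r`: on each of them the
deviation of the average from `a` is comparable to `T`, and off them `f - a` is bounded on `E`. -/
structure IsStoppingCover (μ : Measure (Euc d)) (n : ℕ) (C₀ η ρ β : ℝ) (f : Euc d → ℝ)
    (M a T C₁ l : ℝ) (E t : Set (Euc d)) (r : Euc d → ℝ) : Prop where
  countable : t.Countable
  inSupp : ∀ y ∈ t, InSupp μ y
  pos : ∀ y ∈ t, 0 < r y
  le : ∀ y ∈ t, r y ≤ l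
  isDoubling : ∀ y ∈ t, IsDoubling μ ρ β ⟨y, r y⟩
  lt_abs : ∀ y ∈ t, T * M < |cubeAvg μ ⟨y, r y⟩ f - a|
  abs_le : ∀ y ∈ t, |cubeAvg μ ⟨y, r y⟩ f - a| ≤ (T + C₁ + coeffBound n C₀ ρ β 4) * M
  ae_abs_le : ∀ᵐ z ∂μ, z ∈ E → z ∉ ⋃ y ∈ t, (Cube.mk y (r y)).set →
    |f z - a| ≤ (T + C₁ + approxBound d η) * M
  tsum_le : ∀ (ν : Measure (Euc d)) (W : Set (Euc d)), (∀ y ∈ E, (Cube.mk y l).set ⊆ W) →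
    ∑' y : t, ν (Cube.mk (y : Euc d) (r y)).set ≤ overlapBound d * ν W

theorem HasRbmoBound.exists_isStoppingCover [IsLocallyFiniteMeasure μ]
    (h : HasRbmoBound μ n C₀ η ρ β f M) {l a T C₁ : ℝ} {E : Set (Euc d)} (hl : 0 < l) (hl1 : l ≤ 1)
    (hC₁ : ∀ y ∈ E, InSupp μ y → ∀ r, l ≤ r → IsDoubling μ ρ β ⟨y, r⟩ →
      (∀ v, 2 * l ≤ v → v < r / 2 → ¬ IsDoubling μ ρ β ⟨y, v⟩) →
      |cubeAvg μ ⟨y, r⟩ f - a| ≤ C₁ * M) (hT : 0 ≤ T) (hC₁0 : 0 ≤ C₁) :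
    ∃ t r, IsStoppingCover μ n C₀ η ρ β f M a T C₁ l E t r := by
  set G := {y | y ∈ E ∧ IsApproxPoint μ ρ β f (approxBound d η * M) y ∧
    ¬ |f y - a| ≤ (T + C₁ + approxBound d η) * M} with hG
  have hex : ∀ y ∈ G, ∃ r, 0 < r ∧ r ≤ l ∧ IsDoubling μ ρ β ⟨y, r⟩ ∧
      T * M < |cubeAvg μ ⟨y, r⟩ f - a| ∧
      |cubeAvg μ ⟨y, r⟩ f - a| ≤ (T + C₁ + coeffBound n C₀ ρ β 4) * M := fun y hy =>
    (h.abs_sub_le_or_exists_stopping hy.2.1 hl hl1 (hC₁ y hy.1 hy.2.1.1) hT hC₁0).resolve_left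
      hy.2.2
  choose! r hr using hex
  obtain ⟨t, htG, htc, hcov, htsum⟩ := (Cube.exists_besicovitch_cover d).choose_spec.2 G r l
    (fun y hy => (hr y hy).1) fun y hy => (hr y hy).2.1
  refine ⟨t, r, htc, fun y hy => (htG hy).2.1.1, fun y hy => (hr y (htG hy)).1,
    fun y hy => (hr y (htG hy)).2.1, fun y hy => (hr y (htG hy)).2.2.1,
    fun y hy => (hr y (htG hy)).2.2.2.1, fun y hy => (hr y (htG hy)).2.2.2.2, ?_, ?_⟩
  · filter_upwards [h.ae_isApproxPoint] with z hz hzE hzt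
    by_contra hcon
    exact hzt (hcov ⟨hzE, hz, hcon⟩)
  · exact fun ν W hW => htsum ν W fun y hy =>
      (Cube.set_mono y (hr y hy).1.le (hr y hy).2.1).trans (hW y hy.1)

end StoppingCubes

section JohnNirenberg

variable {d n : ℕ} {μ : Measure (Euc d)} {C₀ η ρ β M : ℝ} {f : Euc d → ℝ} {x y : Euc d}

/-- The relative size of the stopping cubes. -/
def stopRatio (ρ : ℝ) : ℝ := min ((ρ - 1) / 2) 1

/-- The constant in the comparison of averages over nearby doubling cubes. -/
def nearbyBound (n : ℕ) (C₀ ρ β : ℝ) : ℝ := 2 * coeffBound n C₀ ρ β (8 / stopRatio ρ) + 2 * β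

/-- The constant in the bound for the mean oscillation on a slightly enlarged doubling cube. -/
def enlargedBound (d n : ℕ) (C₀ η ρ β : ℝ) : ℝ :=
  ((β + (nearbyBound n C₀ ρ β + coeffBound n C₀ ρ β 4)) * overlapBound d
    + (nearbyBound n C₀ ρ β + approxBound d η)) * β

/-- The height of the stopping cubes in the John–Nirenberg iteration. -/
def stopHeight (d n : ℕ) (C₀ η ρ β : ℝ) : ℝ := 2 * overlapBound d * enlargedBound d n C₀ η ρ β

/-- The step of the level sets in the John–Nirenberg inequality. -/
def levelStep (d n : ℕ) (C₀ η ρ β : ℝ) : ℝ :=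
  stopHeight d n C₀ η ρ β + (nearbyBound n C₀ ρ β + β)
    + coeffBound n C₀ ρ β 4 + coeffBound n C₀ ρ β 4 + approxBound d η

theorem one_le_approxBound : 1 ≤ approxBound d η := by
  rw [approxBound]
  exact le_add_of_nonneg_right (by positivity)

theorem HasCubeGrowth.stopRatio_pos (H : HasCubeGrowth μ n C₀ ρ β) : 0 < stopRatio ρ :=
  lt_min (by linarith [H.one_lt]) one_pos

theorem HasCubeGrowth.one_le_nearbyBound (H : HasCubeGrowth μ n C₀ ρ β) :
    1 ≤ nearbyBound n C₀ ρ β := by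
  have := H.one_le_coeffBound (L := 8 / stopRatio ρ) (by have := H.stopRatio_pos; positivity)
  have := H.beta_pos
  rw [nearbyBound]
  linarith

theorem HasCubeGrowth.enlargedBound_pos (H : HasCubeGrowth μ n C₀ ρ β) (η : ℝ) :
    0 < enlargedBound d n C₀ η ρ β := by
  have h1 := H.one_le_nearbyBound
  have h2 := H.beta_pos
  have h3 := H.one_le_coeffBound (L := 4) (by norm_num)
  have h4 := one_le_approxBound (d := d) (η := η)
  rw [enlargedBound]
  refine mul_pos (add_pos_of_nonneg_of_pos (mul_nonneg (by linarith) (by positivity)) ?_) h2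
  linarith

theorem HasCubeGrowth.stopHeight_pos (H : HasCubeGrowth μ n C₀ ρ β) (η : ℝ) :
    0 < stopHeight d n C₀ η ρ β := by
  have h1 := H.enlargedBound_pos (d := d) η
  have h2 := overlapBound_pos (d := d)
  rw [stopHeight]
  positivity

theorem HasCubeGrowth.levelStep_pos (H : HasCubeGrowth μ n C₀ ρ β) (η : ℝ) :
    0 < levelStep d n C₀ η ρ β := by
  have h1 := H.stopHeight_pos (d := d) η
  have h2 := H.beta_pos
  have h3 := H.one_le_coeffBound (L := 4) (by norm_num)
  have h4 := one_le_approxBound (d := d) (η := η)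
  have h5 := H.one_le_nearbyBound
  rw [levelStep]
  positivity

namespace IsStoppingCover

variable {a T C₁ l : ℝ} {E W t : Set (Euc d)} {r : Euc d → ℝ}

/-- A distributional estimate on the stopping cubes yields one on the initial set. -/
theorem measure_lt_abs_le (S : IsStoppingCover μ n C₀ η ρ β f M a T C₁ l E t r) {s s' : ℝ}
    {q : ℝ≥0∞} (hs₁ : s' + (T + C₁ + coeffBound n C₀ ρ β 4) * M ≤ s)
    (hs₂ : (T + C₁ + approxBound d η) * M ≤ s)
    (hq : ∀ y ∈ t, μ ((Cube.mk y (r y)).set ∩ {z | s' < |f z - cubeAvg μ ⟨y, r y⟩ f|})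
      ≤ q * μ (Cube.mk y (r y)).set) :
    μ (E ∩ {z | s < |f z - a|}) ≤ q * ∑' y : t, μ (Cube.mk (y : Euc d) (r y)).set := by
  have := S.countable.to_subtype
  calc μ (E ∩ {z | s < |f z - a|})
      ≤ μ (⋃ y : t, (Cube.mk (y : Euc d) (r y)).set
          ∩ {z | s' < |f z - cubeAvg μ ⟨y, r y⟩ f|}) := by
        refine measure_mono_ae ?_
        filter_upwards [S.ae_abs_le] with z hz hzE
        have hzs : s < |f z - a| := hzE.2
        have hzU : z ∈ ⋃ y ∈ t, (Cube.mk y (r y)).set := by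
          by_contra hcon
          linarith [hz hzE.1 hcon]
        obtain ⟨y, hyt, hzy⟩ := mem_iUnion₂.1 hzU
        refine mem_iUnion.2 ⟨⟨y, hyt⟩, hzy, ?_⟩
        have h1 := abs_sub_le (f z) (cubeAvg μ ⟨y, r y⟩ f) a
        have h2 := S.abs_le y hyt
        show s' < |f z - cubeAvg μ ⟨y, r y⟩ f|
        linarith
    _ ≤ ∑' y : t, μ ((Cube.mk (y : Euc d) (r y)).set
          ∩ {z | s' < |f z - cubeAvg μ ⟨y, r y⟩ f|}) := measure_iUnion_le _
    _ ≤ _ := by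
        rw [← ENNReal.tsum_mul_left]
        exact ENNReal.tsum_le_tsum fun y => hq y y.2

end IsStoppingCover

variable [IsLocallyFiniteMeasure μ]

theorem ofReal_abs_avg_sub_mul_le {Q : Cube d} (hf : IntegrableOn f Q.set μ) (a : ℝ) :
    ENNReal.ofReal |cubeAvg μ Q f - a| * μ Q.set ≤ ∫⁻ z in Q.set, ‖f z - a‖ₑ ∂μ := by
  have hfin := (measure_cube_lt_top (μ := μ) Q).ne
  rcases eq_or_ne (μ Q.set) 0 with h0 | h0
  · simp [h0]
  have hpos : 0 < (μ Q.set).toReal := ENNReal.toReal_pos h0 hfin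
  have h2 : (cubeAvg μ Q f - a) * (μ Q.set).toReal = ∫ z in Q.set, (f z - a) ∂μ := by
    rw [integral_sub hf (integrableOn_const hfin), setIntegral_const, cubeAvg, measureReal_def,
      smul_eq_mul]
    field_simp
  calc ENNReal.ofReal |cubeAvg μ Q f - a| * μ Q.set
      = ‖(cubeAvg μ Q f - a) * (μ Q.set).toReal‖ₑ := by
        rw [enorm_mul, Real.enorm_eq_ofReal_abs, Real.enorm_eq_ofReal_abs, abs_of_pos hpos,
          ENNReal.ofReal_toReal hfin]
    _ ≤ _ := by
        rw [h2]
        exact enorm_integral_le_lintegral_enorm _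

namespace IsStoppingCover

variable {a T C₁ l : ℝ} {E W t : Set (Euc d)} {r : Euc d → ℝ}

theorem lintegral_cube_le (h : HasRbmoBound μ n C₀ η ρ β f M)
    (S : IsStoppingCover μ n C₀ η ρ β f M a T C₁ l E t r) (hl1 : l ≤ 1) (hy : y ∈ t) :
    ∫⁻ z in (Cube.mk y (r y)).set, ‖f z - a‖ₑ ∂μ
      ≤ ENNReal.ofReal ((β + (T + C₁ + coeffBound n C₀ ρ β 4)) * M)
        * μ (Cube.mk y (r y)).set := by
  have hb := S.abs_le y hy
  set b := cubeAvg μ ⟨y, r y⟩ f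
  calc _ ≤ ∫⁻ z in (Cube.mk y (r y)).set, (‖f z - b‖ₑ + ‖b - a‖ₑ) ∂μ := by
        refine lintegral_mono fun z => ?_
        rw [← sub_add_sub_cancel (f z) b a]
        exact enorm_add_le _ _
    _ = (∫⁻ z in (Cube.mk y (r y)).set, ‖f z - b‖ₑ ∂μ) + ‖b - a‖ₑ * μ (Cube.mk y (r y)).set := by
        rw [lintegral_add_right _ measurable_const, setLIntegral_const]
    _ ≤ ENNReal.ofReal (β * M) * μ (Cube.mk y (r y)).set
        + ENNReal.ofReal ((T + C₁ + coeffBound n C₀ ρ β 4) * M) * μ (Cube.mk y (r y)).set := by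
        gcongr
        · exact h.lintegral_sub_avg_le (S.inSupp y hy) (S.pos y hy) ((S.le y hy).trans hl1)
            (S.isDoubling y hy)
        · rw [Real.enorm_eq_ofReal_abs]
          exact ENNReal.ofReal_le_ofReal hb
    _ = _ := by
        rw [← add_mul, ← ENNReal.ofReal_add (mul_nonneg h.growth.beta_pos.le h.pos.le)
          ((abs_nonneg _).trans hb)]
        ring_nf

theorem lintegral_le (h : HasRbmoBound μ n C₀ η ρ β f M)
    (S : IsStoppingCover μ n C₀ η ρ β f M a T C₁ l E t r) (hl1 : l ≤ 1)
    (hW : ∀ y ∈ E, (Cube.mk y l).set ⊆ W) :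
    ∫⁻ z in E, ‖f z - a‖ₑ ∂μ
      ≤ ENNReal.ofReal ((β + (T + C₁ + coeffBound n C₀ ρ β 4)) * M) * (overlapBound d * μ W)
        + ENNReal.ofReal ((T + C₁ + approxBound d η) * M) * μ E := by
  have := S.countable.to_subtype
  set U := ⋃ y ∈ t, (Cube.mk y (r y)).set with hU
  have hUm : MeasurableSet U :=
    MeasurableSet.biUnion S.countable fun y _ => Cube.measurableSet_set _
  rw [← lintegral_inter_add_sdiff (fun z => ‖f z - a‖ₑ) E hUm]
  refine add_le_add ?_ ?_
  · calc ∫⁻ z in E ∩ U, ‖f z - a‖ₑ ∂μ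
        ≤ ∫⁻ z in ⋃ y : t, (Cube.mk (y : Euc d) (r y)).set, ‖f z - a‖ₑ ∂μ := by
          refine lintegral_mono_set ?_
          rw [hU, biUnion_eq_iUnion]
          exact inter_subset_right
      _ ≤ ∑' y : t, ∫⁻ z in (Cube.mk (y : Euc d) (r y)).set, ‖f z - a‖ₑ ∂μ :=
          lintegral_iUnion_le _ _
      _ ≤ ∑' y : t, ENNReal.ofReal ((β + (T + C₁ + coeffBound n C₀ ρ β 4)) * M)
            * μ (Cube.mk (y : Euc d) (r y)).set :=
          ENNReal.tsum_le_tsum fun y => S.lintegral_cube_le h hl1 y.2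
      _ ≤ _ := by
          rw [ENNReal.tsum_mul_left]
          gcongr
          exact S.tsum_le μ W hW
  · calc ∫⁻ z in E \ U, ‖f z - a‖ₑ ∂μ
        ≤ ∫⁻ _ in E \ U, ENNReal.ofReal ((T + C₁ + approxBound d η) * M) ∂μ := by
          refine setLIntegral_mono_ae measurable_const.aemeasurable ?_
          filter_upwards [S.ae_abs_le] with z hz hzE
          rw [Real.enorm_eq_ofReal_abs]
          exact ENNReal.ofReal_le_ofReal (hz hzE.1 hzE.2)
      _ ≤ _ := by
          rw [setLIntegral_const]
          gcongr
          exact sdiff_subset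

theorem ofReal_mul_tsum_le (h : HasRbmoBound μ n C₀ η ρ β f M)
    (S : IsStoppingCover μ n C₀ η ρ β f M a T C₁ l E t r)
    (hWm : MeasurableSet W) (hW : ∀ y ∈ E, (Cube.mk y l).set ⊆ W) :
    ENNReal.ofReal (T * M) * ∑' y : t, μ (Cube.mk (y : Euc d) (r y)).set
      ≤ overlapBound d * ∫⁻ z in W, ‖f z - a‖ₑ ∂μ := by
  have h1 := S.tsum_le (μ.withDensity fun z => ‖f z - a‖ₑ) W hW
  rw [withDensity_apply _ hWm] at h1
  refine le_trans ?_ h1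
  rw [← ENNReal.tsum_mul_left]
  refine ENNReal.tsum_le_tsum fun y => ?_
  rw [withDensity_apply _ (Cube.measurableSet_set _)]
  refine le_trans ?_ (ofReal_abs_avg_sub_mul_le (h.integrableOn_cube _) a)
  gcongr
  exact (S.lt_abs y y.2).le

end IsStoppingCover

namespace HasRbmoBound

variable {l : ℝ}

/-- The average over `Q(x, l)` controls those over nearby doubling cubes. -/
theorem abs_avg_sub_avg_le_nearbyBound (h : HasRbmoBound μ n C₀ η ρ β f M) (hx : InSupp μ x)
    (hl : 0 < l) (hl1 : l ≤ 1) (hdx : IsDoubling μ ρ β ⟨x, l⟩)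
    (hyx : y ∈ (Cube.mk x ((1 + stopRatio ρ) * l)).set) (hy : InSupp μ y) {r : ℝ}
    (hr : stopRatio ρ * l ≤ r) (hdr : IsDoubling μ ρ β ⟨y, r⟩)
    (hnd : ∀ v, 2 * (stopRatio ρ * l) ≤ v → v < r / 2 → ¬ IsDoubling μ ρ β ⟨y, v⟩) :
    |cubeAvg μ ⟨y, r⟩ f - cubeAvg μ ⟨x, l⟩ f| ≤ nearbyBound n C₀ ρ β * M := by
  have hε := h.growth.stopRatio_pos
  have hε1 : stopRatio ρ ≤ 1 := min_le_right _ _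
  refine h.abs_avg_sub_avg_le hx hy hl hl1 hε hε1 ?_ hdx hr hdr hnd
  rw [Cube.mem_set_iff (by positivity), dist_comm] at hyx
  nlinarith

theorem lintegral_enlarged_le (h : HasRbmoBound μ n C₀ η ρ β f M) (hx : InSupp μ x)
    (hl : 0 < l) (hl1 : l ≤ 1) (hdx : IsDoubling μ ρ β ⟨x, l⟩) :
    ∫⁻ z in (Cube.mk x ((1 + stopRatio ρ) * l)).set, ‖f z - cubeAvg μ ⟨x, l⟩ f‖ₑ ∂μ
      ≤ ENNReal.ofReal (enlargedBound d n C₀ η ρ β * M) * μ (Cube.mk x l).set := by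
  have hε := h.growth.stopRatio_pos
  have hε1 : stopRatio ρ ≤ 1 := min_le_right _ _
  have hερ : stopRatio ρ ≤ (ρ - 1) / 2 := min_le_left _ _
  have hM := h.pos
  have hβ := h.growth.beta_pos
  have h1 := h.growth.one_le_nearbyBound
  have h3 := h.growth.one_le_coeffBound (L := 4) (by norm_num)
  have h4 := one_le_approxBound (d := d) (η := η)
  set E := (Cube.mk x ((1 + stopRatio ρ) * l)).set with hE
  have hl' : stopRatio ρ * l ≤ 1 := by nlinarith
  obtain ⟨t, r, S⟩ := h.exists_isStoppingCover (l := stopRatio ρ * l) (T := 0) (E := E)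
    (a := cubeAvg μ ⟨x, l⟩ f) (C₁ := nearbyBound n C₀ ρ β) (by positivity) hl'
    (fun y hy hys r hr hdr hnd =>
      h.abs_avg_sub_avg_le_nearbyBound hx hl hl1 hdx hy hys hr hdr hnd) le_rfl (by linarith)
  have hW : ∀ y ∈ E, (Cube.mk y (stopRatio ρ * l)).set ⊆ (Cube.mk x (ρ * l)).set := by
    intro y hy
    rw [hE, Cube.mem_set_iff (by positivity)] at hy
    exact Cube.set_subset_set (by positivity) (by nlinarith)
  have hWd : μ (Cube.mk x (ρ * l)).set ≤ ENNReal.ofReal β * μ (Cube.mk x l).set := hdx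
  have hEd : μ E ≤ ENNReal.ofReal β * μ (Cube.mk x l).set :=
    (measure_mono (Cube.set_mono x (by positivity) (by nlinarith))).trans hWd
  refine (S.lintegral_le h hl' hW).trans ?_
  calc _ ≤ ENNReal.ofReal ((β + (0 + nearbyBound n C₀ ρ β + coeffBound n C₀ ρ β 4)) * M)
            * (ENNReal.ofReal (overlapBound d) * (ENNReal.ofReal β * μ (Cube.mk x l).set))
          + ENNReal.ofReal ((0 + nearbyBound n C₀ ρ β + approxBound d η) * M)
            * (ENNReal.ofReal β * μ (Cube.mk x l).set) := by
        rw [ENNReal.ofReal_natCast]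
        gcongr
    _ = _ := by
        have h5 : 0 ≤ (β + (0 + nearbyBound n C₀ ρ β + coeffBound n C₀ ρ β 4)) * M :=
          mul_nonneg (by linarith) hM.le
        have h6 : 0 ≤ (0 + nearbyBound n C₀ ρ β + approxBound d η) * M :=
          mul_nonneg (by linarith) hM.le
        rw [← mul_assoc (ENNReal.ofReal (overlapBound d)), ← mul_assoc, ← mul_assoc,
          ← mul_assoc (ENNReal.ofReal (_ * M)) (ENNReal.ofReal β), ← add_mul,
          ← ENNReal.ofReal_mul h5, ← ENNReal.ofReal_mul (mul_nonneg h5 (Nat.cast_nonneg _)),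
          ← ENNReal.ofReal_mul h6, ← ENNReal.ofReal_add
            (mul_nonneg (mul_nonneg h5 (Nat.cast_nonneg _)) hβ.le) (mul_nonneg h6 hβ.le),
          enlargedBound]
        congr 2
        ring

/-- The John–Nirenberg inequality on doubling cubes. -/
theorem measure_lt_abs_sub_avg_le (h : HasRbmoBound μ n C₀ η ρ β f M) (k : ℕ) :
    ∀ x l, InSupp μ x → 0 < l → l ≤ 1 → IsDoubling μ ρ β ⟨x, l⟩ →
      μ ((Cube.mk x l).set ∩
          {z | k * (levelStep d n C₀ η ρ β * M) < |f z - cubeAvg μ ⟨x, l⟩ f|})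
        ≤ 2⁻¹ ^ k * μ (Cube.mk x l).set := by
  have hM := h.pos
  have hβ := h.growth.beta_pos
  have h1 := h.growth.one_le_nearbyBound
  have h3 := h.growth.one_le_coeffBound (L := 4) (by norm_num)
  have h4 := one_le_approxBound (d := d) (η := η)
  have hT := h.growth.stopHeight_pos (d := d) η
  have hε := h.growth.stopRatio_pos
  have hε1 : stopRatio ρ ≤ 1 := min_le_right _ _
  induction k with
  | zero =>
    intro x l _ _ _ _
    simpa using measure_mono inter_subset_left
  | succ k ih =>
    intro x l hx hl hl1 hdx
    have hl' : stopRatio ρ * l ≤ 1 := by nlinarith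
    have hQE : (Cube.mk x l).set ⊆ (Cube.mk x ((1 + stopRatio ρ) * l)).set :=
      Cube.set_mono x hl.le (by nlinarith)
    obtain ⟨t, r, S⟩ := h.exists_isStoppingCover (l := stopRatio ρ * l)
      (T := stopHeight d n C₀ η ρ β) (E := (Cube.mk x l).set)
      (a := cubeAvg μ ⟨x, l⟩ f) (C₁ := nearbyBound n C₀ ρ β) (by positivity) hl'
      (fun y hy hys r hr hdr hnd =>
        h.abs_avg_sub_avg_le_nearbyBound hx hl hl1 hdx (hQE hy) hys hr hdr hnd) hT.le (by linarith)
    have hW : ∀ y ∈ (Cube.mk x l).set, (Cube.mk y (stopRatio ρ * l)).set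
        ⊆ (Cube.mk x ((1 + stopRatio ρ) * l)).set := by
      intro y hy
      rw [Cube.mem_set_iff hl.le] at hy
      exact Cube.set_subset_set (by positivity) (by nlinarith)
    have hsum : ∑' y : t, μ (Cube.mk (y : Euc d) (r y)).set ≤ 2⁻¹ * μ (Cube.mk x l).set := by
      have h5 := (S.ofReal_mul_tsum_le h (Cube.measurableSet_set _) hW).trans
        (mul_le_mul_right (h.lintegral_enlarged_le hx hl hl1 hdx) _)
      have h6 : (overlapBound d : ℝ≥0∞) * (ENNReal.ofReal (enlargedBound d n C₀ η ρ β * M)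
          * μ (Cube.mk x l).set)
          = ENNReal.ofReal (stopHeight d n C₀ η ρ β * M) * (2⁻¹ * μ (Cube.mk x l).set) := by
        rw [← mul_assoc, ← mul_assoc, ← ENNReal.ofReal_natCast,
          show (2⁻¹ : ℝ≥0∞) = ENNReal.ofReal 2⁻¹ by
            rw [ENNReal.ofReal_inv_of_pos two_pos, ENNReal.ofReal_ofNat],
          ← ENNReal.ofReal_mul (by positivity), ← ENNReal.ofReal_mul (by positivity), stopHeight]
        congr 2
        ring
      rw [h6] at h5
      have hTM : ENNReal.ofReal (stopHeight d n C₀ η ρ β * M) ≠ 0 :=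
        (ENNReal.ofReal_pos.2 (by positivity)).ne'
      exact (ENNReal.mul_le_mul_iff_right hTM ENNReal.ofReal_ne_top).1 h5
    have hstep : (stopHeight d n C₀ η ρ β + nearbyBound n C₀ ρ β + coeffBound n C₀ ρ β 4
        + approxBound d η) * M ≤ levelStep d n C₀ η ρ β * M := by
      rw [levelStep]
      gcongr ?_ * _
      linarith
    have hnn : 0 ≤ (k : ℝ) * (levelStep d n C₀ η ρ β * M) := by
      rw [levelStep]
      positivity
    refine (S.measure_lt_abs_le (s' := k * (levelStep d n C₀ η ρ β * M)) (q := 2⁻¹ ^ k)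
      ?_ ?_ fun y hy => ih y (r y) (S.inSupp y hy) (S.pos y hy) ((S.le y hy).trans hl')
        (S.isDoubling y hy)).trans ?_
    · push_cast
      nlinarith
    · push_cast
      nlinarith
    · calc _ ≤ 2⁻¹ ^ k * (2⁻¹ * μ (Cube.mk x l).set) := by gcongr
        _ = _ := by rw [pow_succ, mul_assoc]

/-- The John–Nirenberg inequality on cubes of side length one, without subtracting averages. -/
theorem measure_lt_abs_le (h : HasRbmoBound μ n C₀ η ρ β f M) (hx : InSupp μ x) (k : ℕ) :
    μ ((Cube.mk x 1).set ∩ {z | (k + 1) * (levelStep d n C₀ η ρ β * M) < |f z|})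
      ≤ 2⁻¹ ^ k * (overlapBound d * ENNReal.ofReal (C₀ * 2 ^ n)) := by
  have hM := h.pos
  have hβ := h.growth.beta_pos
  have h1 := h.growth.one_le_nearbyBound
  have h3 := h.growth.one_le_coeffBound (L := 4) (by norm_num)
  have h4 := one_le_approxBound (d := d) (η := η)
  have hT := h.growth.stopHeight_pos (d := d) η
  obtain ⟨t, r, S⟩ := h.exists_isStoppingCover (l := 1) (T := 0) (E := (Cube.mk x 1).set)
    (a := 0) (C₁ := coeffBound n C₀ ρ β 4 + β) one_pos le_rfl
    (by
      intro y _ hy r hr hdr _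
      rw [sub_zero]
      rcases hr.eq_or_lt with rfl | hr
      · obtain ⟨t, hrt, hdt, hndt⟩ := h.growth.exists_next_doubling hy
          (show 0 < 2 * (1 : ℝ) by positivity)
        have h5 := h.abs_avg_sub_next_le hy one_pos le_rfl hrt hdr hdt hndt
        have h6 := h.abs_avg_le hy (show 1 < t by linarith) hdt
        have h7 := abs_sub_le (cubeAvg μ ⟨y, 1⟩ f) (cubeAvg μ ⟨y, t⟩ f) 0
        rw [sub_zero, sub_zero] at h7
        linarith
      · have := h.abs_avg_le hy hr hdr
        nlinarith) le_rfl (by linarith)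
  have hW : ∀ y ∈ (Cube.mk x 1).set, (Cube.mk y 1).set ⊆ (Cube.mk x 2).set := by
    intro y hy
    rw [Cube.mem_set_iff zero_le_one] at hy
    exact Cube.set_subset_set zero_le_one (by linarith)
  have hstep : (0 + (coeffBound n C₀ ρ β 4 + β) + coeffBound n C₀ ρ β 4 + approxBound d η) * M
      ≤ levelStep d n C₀ η ρ β * M := by
    rw [levelStep]
    gcongr ?_ * _
    linarith
  have hnn : 0 ≤ (k : ℝ) * (levelStep d n C₀ η ρ β * M) := by
    rw [levelStep]
    positivity
  have h5 := S.measure_lt_abs_le (s := (k + 1) * (levelStep d n C₀ η ρ β * M))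
    (s' := k * (levelStep d n C₀ η ρ β * M)) (q := 2⁻¹ ^ k)
    (by nlinarith) (by nlinarith) fun y hy => h.measure_lt_abs_sub_avg_le k y (r y)
      (S.inSupp y hy) (S.pos y hy) (S.le y hy) (S.isDoubling y hy)
  simp only [sub_zero] at h5
  refine h5.trans ?_
  gcongr
  exact (S.tsum_le μ _ hW).trans (mul_le_mul_right (h.growth.measure_le x 2 hx two_pos) _)

end HasRbmoBound

end JohnNirenberg

section Orlicz

theorem wp_mul_div_sq_le {u v p L : ℝ} (hu : 0 ≤ u) (hv : 0 ≤ v) (hp : 0 < p) (hL : 1 ≤ L) :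
    wp (u * v / L ^ 2) ≤ 2 / L * (Real.exp (p * u) + p⁻¹ * v) := by
  have huv : 0 ≤ u * v := mul_nonneg hu hv
  have hL0 : 0 < L := zero_lt_one.trans_le hL
  have he : 1 ≤ Real.exp 1 := Real.one_le_exp zero_le_one
  have hlog : ∀ t : ℝ, 0 ≤ t → 1 ≤ Real.log (Real.exp 1 + t) := fun t ht =>
    (Real.le_log_iff_exp_le (by positivity)).2 (by linarith)
  have h1 : wp (u * v) ≤ Real.exp (p * u) + p⁻¹ * v := by
    have hpos : 0 < Real.log (Real.exp 1 + u * v) := zero_lt_one.trans_le (hlog _ huv)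
    have hE := Real.exp_pos (p * u)
    rw [wp, div_le_iff₀ hpos]
    rcases le_or_gt (u * v) (Real.exp (p * u)) with h | h
    · calc u * v ≤ Real.exp (p * u) * 1 := by linarith
        _ ≤ (Real.exp (p * u) + p⁻¹ * v) * Real.log (Real.exp 1 + u * v) := by
          gcongr
          · exact le_add_of_nonneg_right (by positivity)
          · exact hlog _ huv
    · have h2 : p * u ≤ Real.log (Real.exp 1 + u * v) :=
        (Real.le_log_iff_exp_le (by positivity)).2 (by linarith)
      calc u * v = p⁻¹ * v * (p * u) := by field_simp
        _ ≤ (Real.exp (p * u) + p⁻¹ * v) * Real.log (Real.exp 1 + u * v) := by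
          gcongr
          exact le_add_of_nonneg_left hE.le
  have h2 : wp (u * v / L ^ 2) ≤ 2 / L * wp (u * v) := by
    set s := u * v
    have hs1 := hlog _ huv
    have hs2 := hlog (s / L ^ 2) (by positivity)
    have h3 : Real.log (Real.exp 1 + s) ≤ Real.log (Real.exp 1 + s / L ^ 2) + 2 * Real.log L := by
      rw [show 2 * Real.log L = Real.log (L ^ 2) by rw [Real.log_pow]; norm_num,
        ← Real.log_mul (by positivity) (by positivity)]
      refine Real.log_le_log (by positivity) ?_
      rw [add_mul, div_mul_cancel₀ _ (by positivity)]
      have : (1 : ℝ) ≤ L ^ 2 := one_le_pow₀ hL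
      nlinarith
    have h4 := Real.log_le_sub_one_of_pos hL0
    have h5 : Real.log (Real.exp 1 + s) ≤ 2 * L * Real.log (Real.exp 1 + s / L ^ 2) := by
      nlinarith
    rw [wp, wp, div_div, div_mul_div_comm, div_le_div_iff₀ (by positivity) (by positivity)]
    calc s * (L * Real.log (Real.exp 1 + s))
        ≤ s * (L * (2 * L * Real.log (Real.exp 1 + s / L ^ 2))) := by gcongr
      _ = _ := by ring
  exact h2.trans (by gcongr)

variable {α : Type*} [MeasurableSpace α]

/-- Exponential integrability from exponential decay of the distribution function. -/
theorem lintegral_exp_le {ν : Measure α} {g : α → ℝ} (hg : AEMeasurable g ν) {V : ℝ≥0∞} {B : ℝ}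
    (hB : 0 < B) (h0 : ν univ ≤ V) (hk : ∀ k : ℕ, ν {x | (k + 1) * B < g x} ≤ 2⁻¹ ^ k * V) :
    ∫⁻ x, ENNReal.ofReal (Real.exp (Real.log (3 / 2) / B * g x)) ∂ν ≤ 14 * V := by
  set c := ENNReal.ofReal (3 / 2) with hc
  set S : ℕ → Set α := fun k => {x | (k + 1) * B < g x} with hS
  have hlog : 0 < Real.log (3 / 2) := Real.log_pos (by norm_num)
  have hpt : ∀ x, ENNReal.ofReal (Real.exp (Real.log (3 / 2) / B * g x))
      ≤ 2 + 3 * ∑' k, (S k).indicator (fun _ => c ^ k) x := by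
    intro x
    have hexp : ∀ m : ℕ, g x ≤ m * B →
        Real.exp (Real.log (3 / 2) / B * g x) ≤ (3 / 2) ^ m := by
      intro m hm
      rw [← Real.exp_log (show (0 : ℝ) < (3 / 2) ^ m by positivity), Real.log_pow]
      refine Real.exp_le_exp.2 ?_
      calc Real.log (3 / 2) / B * g x ≤ Real.log (3 / 2) / B * (m * B) := by gcongr
        _ = _ := by field_simp
    rcases le_or_gt (g x) B with hx | hx
    · have h1 := hexp 1 (by simpa using hx)
      calc _ ≤ ENNReal.ofReal 2 := ENNReal.ofReal_le_ofReal (by linarith)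
        _ ≤ _ := by simp
    · have hm : 1 < ⌈g x / B⌉₊ := Nat.lt_ceil.2 (by simpa using (one_lt_div hB).2 hx)
      obtain ⟨k, hkm⟩ : ∃ k, ⌈g x / B⌉₊ = k + 2 := ⟨⌈g x / B⌉₊ - 2, by omega⟩
      have hkS : x ∈ S k := by
        have : k + 1 < ⌈g x / B⌉₊ := by omega
        rw [Nat.lt_ceil, lt_div_iff₀ hB] at this
        simpa [hS] using this
      have h1 := hexp (k + 2) (by
        have := Nat.le_ceil (g x / B)
        rwa [hkm, div_le_iff₀ hB] at this)
      have h2 : Real.exp (Real.log (3 / 2) / B * g x) ≤ 3 * (3 / 2) ^ k := by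
        have : (0 : ℝ) < (3 / 2) ^ k := by positivity
        rw [pow_add] at h1
        linarith
      calc _ ≤ ENNReal.ofReal (3 * (3 / 2) ^ k) := ENNReal.ofReal_le_ofReal h2
        _ = 3 * (S k).indicator (fun _ => c ^ k) x := by
          rw [indicator_of_mem hkS, ENNReal.ofReal_mul (by norm_num),
            ENNReal.ofReal_pow (by norm_num), ENNReal.ofReal_ofNat]
        _ ≤ 3 * ∑' k, (S k).indicator (fun _ => c ^ k) x := by
          gcongr
          exact ENNReal.le_tsum k
        _ ≤ _ := le_add_self
  have hSm : ∀ k, NullMeasurableSet (S k) ν := fun k => nullMeasurableSet_lt aemeasurable_const hg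
  have hsum : ∑' k, c ^ k * ν (S k) ≤ 4 * V := by
    calc ∑' k, c ^ k * ν (S k) ≤ ∑' k : ℕ, ENNReal.ofReal (3 / 4) ^ k * V := by
          refine ENNReal.tsum_le_tsum fun k => ?_
          calc c ^ k * ν (S k) ≤ c ^ k * (2⁻¹ ^ k * V) := by gcongr; exact hk k
            _ = _ := by
              rw [← mul_assoc, ← mul_pow, hc, show (2⁻¹ : ℝ≥0∞) = ENNReal.ofReal 2⁻¹ by
                rw [ENNReal.ofReal_inv_of_pos two_pos, ENNReal.ofReal_ofNat],
                ← ENNReal.ofReal_mul (by norm_num)]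
              norm_num
      _ = 4 * V := by
          rw [ENNReal.tsum_mul_right, ENNReal.tsum_geometric, ← ENNReal.ofReal_one,
            ← ENNReal.ofReal_sub _ (by norm_num), ← ENNReal.ofReal_inv_of_pos (by norm_num)]
          norm_num
  calc _ ≤ ∫⁻ x, (2 + 3 * ∑' k, (S k).indicator (fun _ => c ^ k) x) ∂ν := lintegral_mono hpt
    _ = 2 * ν univ + 3 * ∑' k, c ^ k * ν (S k) := by
        rw [lintegral_add_left measurable_const, lintegral_const,
          lintegral_const_mul' _ _ (by norm_num),
          lintegral_tsum fun k => (aemeasurable_const.indicator₀ (hSm k))]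
        simp_rw [lintegral_indicator_const₀ (hSm _)]
    _ ≤ 2 * V + 3 * (4 * V) := by gcongr
    _ = 14 * V := by rw [← mul_assoc, ← add_mul]; norm_num

theorem orliczNormOn_le_ofReal {P : ℝ → ℝ} {lam : Measure α} {E : Set α} {u : α → ℝ} {k : ℝ}
    (hk : 0 < k) (h : ∫⁻ x in E, ENNReal.ofReal (P (|u x| / k)) ∂lam ≤ 1) :
    orliczNormOn P lam E u ≤ ENNReal.ofReal k :=
  sInf_le ⟨ENNReal.ofReal_pos.2 hk, ENNReal.ofReal_ne_top, by rwa [ENNReal.toReal_ofReal hk.le]⟩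

theorem orliczNormOn_wp_eq_zero {lam : Measure α} {E : Set α} {u : α → ℝ}
    (hu : ∀ᵐ x ∂lam.restrict E, u x = 0) : orliczNormOn wp lam E u = 0 := by
  refine le_antisymm (ENNReal.le_of_forall_pos_le_add fun ε hε _ => ?_) zero_le
  rw [zero_add, ← ENNReal.ofReal_coe_nnreal]
  refine orliczNormOn_le_ofReal hε ?_
  rw [lintegral_congr_ae (g := fun _ => 0)]
  · simp
  · filter_upwards [hu] with x hx
    simp [hx, wp]

/-- Exponential integrability of `f` implies an `L¹ → L^℘` bound for the multiplication by `f`. -/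
theorem orliczNormOn_wp_mul_le {lam : Measure α} {E : Set α} {f ψ : α → ℝ} {M p K L : ℝ}
    (hM : 0 < M) (hp : 0 < p) (hK : 0 ≤ K) (hL : 1 ≤ L) (hKL : 2 * (K + p⁻¹) ≤ L)
    (hψ : IntegrableOn ψ E lam)
    (hf : ∫⁻ x in E, ENNReal.ofReal (Real.exp (p * (|f x| / M))) ∂lam ≤ ENNReal.ofReal K) :
    orliczNormOn wp lam E (fun x => f x * ψ x)
      ≤ ENNReal.ofReal (L ^ 2 * M * ∫ x in E, |ψ x| ∂lam) := by
  have hL0 : 0 < L := zero_lt_one.trans_le hL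
  set I := ∫ x in E, |ψ x| ∂lam with hI
  have hI0 : 0 ≤ I := integral_nonneg fun _ => abs_nonneg _
  rcases hI0.eq_or_lt with h0 | hIpos
  · rw [orliczNormOn_wp_eq_zero]
    · exact zero_le
    · have := (integral_eq_zero_iff_of_nonneg (fun x => abs_nonneg (ψ x)) hψ.abs).1 h0.symm
      filter_upwards [this] with x hx
      simp [abs_eq_zero.1 hx]
  refine orliczNormOn_le_ofReal (by positivity) ?_
  have hψI : ∫⁻ x in E, ENNReal.ofReal (|ψ x| / I) ∂lam = 1 := by
    rw [← ofReal_integral_eq_lintegral_ofReal (hψ.abs.div_const I)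
      (Eventually.of_forall fun x => by positivity), integral_div, ← hI, div_self hIpos.ne',
      ENNReal.ofReal_one]
  have hψm : AEMeasurable (fun x => ENNReal.ofReal p⁻¹ * ENNReal.ofReal (|ψ x| / I))
      (lam.restrict E) :=
    ((hψ.abs.aestronglyMeasurable.aemeasurable.div_const I).ennreal_ofReal).const_mul _
  calc ∫⁻ x in E, ENNReal.ofReal (wp (|f x * ψ x| / (L ^ 2 * M * I))) ∂lam
      ≤ ∫⁻ x in E, ENNReal.ofReal (2 / L) * (ENNReal.ofReal (Real.exp (p * (|f x| / M)))
          + ENNReal.ofReal p⁻¹ * ENNReal.ofReal (|ψ x| / I)) ∂lam := by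
        refine lintegral_mono fun x => ?_
        rw [← ENNReal.ofReal_mul (by positivity), ← ENNReal.ofReal_add (by positivity)
          (by positivity), ← ENNReal.ofReal_mul (by positivity)]
        refine ENNReal.ofReal_le_ofReal ?_
        have h1 := wp_mul_div_sq_le (u := |f x| / M) (v := |ψ x| / I) (by positivity)
          (by positivity) hp hL
        rwa [show |f x| / M * (|ψ x| / I) / L ^ 2 = |f x * ψ x| / (L ^ 2 * M * I) by
          rw [abs_mul]; field_simp] at h1
    _ = ENNReal.ofReal (2 / L) * ((∫⁻ x in E, ENNReal.ofReal (Real.exp (p * (|f x| / M))) ∂lam)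
          + ENNReal.ofReal p⁻¹) := by
        rw [lintegral_const_mul' _ _ ENNReal.ofReal_ne_top, lintegral_add_right' _ hψm,
          lintegral_const_mul' _ _ ENNReal.ofReal_ne_top, hψI, mul_one]
    _ ≤ ENNReal.ofReal (2 / L) * (ENNReal.ofReal K + ENNReal.ofReal p⁻¹) := by gcongr
    _ = ENNReal.ofReal (2 * (K + p⁻¹) / L) := by
        rw [← ENNReal.ofReal_add hK (by positivity), ← ENNReal.ofReal_mul (by positivity)]
        congr 1
        ring
    _ ≤ 1 := ENNReal.ofReal_le_one.2 ((div_le_one hL0).2 hKL)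

end Orlicz

/-- Exponential integrability of functions satisfying the `rbmo` conditions, on cubes of side
length one. -/
theorem HasRbmoBound.lintegral_exp_le {d n : ℕ} {μ : Measure (Euc d)} [IsLocallyFiniteMeasure μ]
    {C₀ η ρ β M : ℝ} {f : Euc d → ℝ} {x : Euc d} (h : HasRbmoBound μ n C₀ η ρ β f M)
    (hx : InSupp μ x) :
    ∫⁻ z in (Cube.mk x 1).set,
        ENNReal.ofReal (Real.exp (Real.log (3 / 2) / levelStep d n C₀ η ρ β * (|f z| / M))) ∂μ
      ≤ ENNReal.ofReal (14 * (overlapBound d * (C₀ * 2 ^ n))) := by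
  have hM := h.pos
  have hC := h.growth.C₀_pos
  have hB := h.growth.levelStep_pos (d := d) η
  have hN : (1 : ℝ) ≤ overlapBound d := by exact_mod_cast overlapBound_pos
  rw [ENNReal.ofReal_mul (by norm_num), ENNReal.ofReal_ofNat]
  refine _root_.lintegral_exp_le ?_ hB ?_ fun k => ?_
  · exact ((h.integrableOn_cube _).abs.aestronglyMeasurable.aemeasurable).div_const M
  · rw [Measure.restrict_apply_univ]
    refine (h.growth.measure_le x 1 hx one_pos).trans (ENNReal.ofReal_le_ofReal ?_)
    have h2 : (1 : ℝ) ≤ 2 ^ n := one_le_pow₀ one_le_two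
    calc C₀ * 1 ^ n = 1 * (C₀ * 1) := by simp
      _ ≤ _ := by gcongr
  · rw [Measure.restrict_apply' (Cube.measurableSet_set _), inter_comm]
    have h1 := h.measure_lt_abs_le hx k
    rw [← ENNReal.ofReal_natCast, ← ENNReal.ofReal_mul (by positivity)] at h1
    simpa only [lt_div_iff₀ hM, mul_assoc] using h1

/-- `‖fψ‖_{L^℘(Q,μ)} ≤ C ‖f‖_{rbmo(μ)} ∫_Q |ψ| dμ` for cubes of side 1. -/
theorem rbmoLoc_mul_L1_orlicz
    {d n : ℕ} (μ : Measure (Euc d)) (C₀ η ρ β : ℝ)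
    (hn : 0 < n) (hnd : n ≤ d) (hC₀ : 0 < C₀)
    (hgrowth : ∀ x : Euc d, ∀ r : ℝ, 0 < r →
      μ (Metric.ball x r) ≤ ENNReal.ofReal (C₀ * r ^ n))
    (hgrowthQ : ∀ Q : Cube d, IsCube μ Q → μ Q.set ≤ ENNReal.ofReal (C₀ * Q.side ^ n))
    (hη : 1 < η) (hηρ : η ≤ ρ) (hρ : 1 < ρ) (hβ : ρ ^ n < β) :
    ∃ C : ℝ, 0 < C ∧
      ∀ Q : Cube d, IsCube μ Q → Q.side = 1 →
        ∀ f : Euc d → ℝ, MemRbmoLoc μ n η ρ β f → 0 < rbmoLocNorm μ n η ρ β f →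
          ∀ ψ : Euc d → ℝ, Integrable ψ μ →
            orliczNormOn wp μ Q.set (fun x => f x * ψ x)
              ≤ ENNReal.ofReal
                  (C * rbmoLocNorm μ n η ρ β f * ∫ x in Q.set, |ψ x| ∂μ) := by
  have hfin : IsLocallyFiniteMeasure μ := ⟨fun x => ⟨ball x 1, ball_mem_nhds x one_pos,
    (hgrowth x 1 one_pos).trans_lt ENNReal.ofReal_lt_top⟩⟩
  have H : HasCubeGrowth μ n C₀ ρ β :=
    ⟨hC₀, hρ, hβ, fun x s hx hs => hgrowthQ ⟨x, s⟩ (hx.isCube hs)⟩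
  have hp : 0 < Real.log (3 / 2) / levelStep d n C₀ η ρ β :=
    div_pos (Real.log_pos (by norm_num)) (H.levelStep_pos η)
  set p := Real.log (3 / 2) / levelStep d n C₀ η ρ β
  set K : ℝ := 14 * (overlapBound d * (C₀ * 2 ^ n))
  have hK : 0 ≤ K := by positivity
  set L := max 1 (2 * (K + p⁻¹))
  have hL : 1 ≤ L := le_max_left _ _
  refine ⟨2 * L ^ 2, by positivity, ?_⟩
  rintro ⟨x, _⟩ hQ rfl f hf hnorm ψ hψ
  obtain ⟨M, ⟨hM0, hMb⟩, hM⟩ := exists_lt_of_csInf_lt hf.2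
    (show rbmoLocNorm μ n η ρ β f < 2 * rbmoLocNorm μ n η ρ β f by linarith)
  have hMpos : 0 < M := hnorm.trans_le (csInf_le ⟨0, fun c hc => hc.1⟩ ⟨hM0, hMb⟩)
  have h : HasRbmoBound μ n C₀ η ρ β f M := ⟨H, hη, hηρ, hMpos, hf.1, hMb⟩
  refine (orliczNormOn_wp_mul_le hMpos hp hK hL (le_max_right _ _) hψ.integrableOn
    (h.lintegral_exp_le hQ.2)).trans (ENNReal.ofReal_le_ofReal ?_)
  have hI : 0 ≤ ∫ z in (Cube.mk x 1).set, |ψ z| ∂μ := integral_nonneg fun _ => abs_nonneg _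
  calc _ ≤ L ^ 2 * (2 * rbmoLocNorm μ n η ρ β f) * ∫ z in (Cube.mk x 1).set, |ψ z| ∂μ := by gcongr
    _ = _ := by ring
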